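/- arXiv:1502.00765 — 2 statements merged into one kernel-verified Lean document; each statement's English description precedes it below -/
import Mathlib

section
/- For sufficiently small constants T_s > 0 and T_H > 0 there exist a locally Lipschitz function C of class K∞ and a constant σ > 0 with the following property: for every partition {τ_i}_{i=0}^∞ of [0,∞) with sup_{i≥0}(τ_{i+1} − τ_i) ≤ T_s and all z_0 ∈ ℝ^n, x_0 ∈ ℝ^n, the closed-loop system consisting of the plant ẋ(t) = f(x(t), u(t)) with output y(τ_i) = h(x(τ_i)), the observer ż(t) = f(z(t), u(t)) + k̂(z(t), w(t), u(t)) for t ≥ 0 a.e., the inter-sample predictor ẇ(t) = ∇h(z(t)) f(z(t), u(t)) on each [τ_i, τ_{i+1}) a.e. with resets w(τ_i) = h(x(τ_i)), and the sample-and-hold control u(t) = k(z(jT_H)) for t ∈ [jT_H, (j+1)T_H) and every integer j ≥ 0, with initial conditions z(0) = z_0 and x(0) = x_0, has a unique solution defined for all t ≥ 0, and this solution satisfies |x(t)| + |z(t)| ≤ exp(−σ t) · C(|x_0| + |z_0|) for all t ≥ 0. -/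
open MeasureTheory Set Filter
open scoped RealInnerProductSpace Topology

/-- `(x, z, w, u)` is a (Carathéodory) solution of the delay-free sampled-data closed
loop (2.15), (2.16), (2.17), (2.18): plant `ẋ(t) = f(x(t), u(t))`; observer
`ż(t) = f(z(t), u(t)) + k̂(z(t), w(t), u(t))`; inter-sample predictor
`ẇ(t) = ∇h(z(t))f(z(t), u(t))` on `[τ_i, τ_{i+1})` with resets `w(τ_i) = h(x(τ_i))`;
sample-and-hold control `u(t) = k(z(jT_H))` on `[jT_H, (j+1)T_H)`. -/
def IsClosedLoopSolDF {n m k' : ℕ}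
    (f : EuclideanSpace ℝ (Fin n) → EuclideanSpace ℝ (Fin m) → EuclideanSpace ℝ (Fin n))
    (h : EuclideanSpace ℝ (Fin n) → EuclideanSpace ℝ (Fin k'))
    (khat : EuclideanSpace ℝ (Fin n) → EuclideanSpace ℝ (Fin k') → EuclideanSpace ℝ (Fin m) →
      EuclideanSpace ℝ (Fin n))
    (kctrl : EuclideanSpace ℝ (Fin n) → EuclideanSpace ℝ (Fin m))
    (TH : ℝ) (π : ℕ → ℝ)
    (z₀ x₀ : EuclideanSpace ℝ (Fin n))
    (x z : ℝ → EuclideanSpace ℝ (Fin n)) (w : ℝ → EuclideanSpace ℝ (Fin k'))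
    (u : ℝ → EuclideanSpace ℝ (Fin m)) : Prop :=
  ContinuousOn x (Ici 0) ∧ x 0 = x₀ ∧
  (∀ t, 0 ≤ t → x t = x₀ + ∫ s in (0:ℝ)..t, f (x s) (u s)) ∧
  ContinuousOn z (Ici 0) ∧ z 0 = z₀ ∧
  (∀ t, 0 ≤ t → z t = z₀ + ∫ s in (0:ℝ)..t, (f (z s) (u s) + khat (z s) (w s) (u s))) ∧
  (∀ i : ℕ, ∀ t ∈ Ico (π i) (π (i + 1)),
    w t = h (x (π i)) + ∫ s in (π i)..t, fderiv ℝ h (z s) (f (z s) (u s))) ∧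
  (∀ j : ℕ, ∀ t ∈ Ico ((j : ℝ) * TH) (((j : ℝ) + 1) * TH), u t = kctrl (z ((j : ℝ) * TH)))

section Volterra

variable {E : Type*} [NormedAddCommGroup E]

theorem integral_exp_mul_le {K A t : ℝ} (hA : 0 ≤ A) :
    ∫ s in (0:ℝ)..t, K * (A * Real.exp (2 * K * s)) ≤ A / 2 * Real.exp (2 * K * t) := by
  have hd : ∀ s ∈ uIcc 0 t, HasDerivAt (fun s => A / 2 * Real.exp (2 * K * s))
      (K * (A * Real.exp (2 * K * s))) s := fun s _ => by
    have h1 : HasDerivAt (fun s : ℝ => 2 * K * s) (2 * K) s := by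
      simpa using (hasDerivAt_id s).const_mul (2 * K)
    exact (h1.exp.const_mul (A / 2)).congr_deriv (by ring)
  rw [intervalIntegral.integral_eq_sub_of_hasDerivAt hd
    (Continuous.intervalIntegrable (by fun_prop) _ _)]
  simp only [mul_zero, Real.exp_zero, mul_one]
  linarith

/-- Gronwall's inequality with a running supremum on the right-hand side. -/
theorem norm_le_exp_of_causal_bound [NormedSpace ℝ E] {T K : ℝ} (hK : 0 < K) {g G : ℝ → E} {g₀ : E}
    (hg : ContinuousOn g (Icc 0 T)) (hint : ∀ t ∈ Icc 0 T, g t = g₀ + ∫ s in (0:ℝ)..t, G s)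
    (hG : ∀ t ∈ Icc 0 T, ∀ d, (∀ s ∈ Icc 0 t, ‖g s‖ ≤ d) → ‖G t‖ ≤ K * d) :
    ∀ t ∈ Icc 0 T, ‖g t‖ ≤ 2 * Real.exp (2 * K * t) * ‖g₀‖ := by
  intro t ht
  have hne : (Icc 0 T).Nonempty := ⟨t, ht⟩
  obtain ⟨τ, hτ, hmax⟩ := isCompact_Icc.exists_isMaxOn hne
    (f := fun t => Real.exp (-(2 * K * t)) * ‖g t‖) (by fun_prop)
  set A := Real.exp (-(2 * K * τ)) * ‖g τ‖ with hA
  have hA0 : 0 ≤ A := by positivity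
  have hgle : ∀ s ∈ Icc 0 T, ‖g s‖ ≤ A * Real.exp (2 * K * s) := fun s hs => by
    have h1 : Real.exp (-(2 * K * s)) * ‖g s‖ ≤ A := hmax hs
    calc ‖g s‖ = Real.exp (-(2 * K * s)) * ‖g s‖ * Real.exp (2 * K * s) := by
          rw [mul_right_comm, ← Real.exp_add]; simp
      _ ≤ _ := by gcongr
  have hGle : ∀ s ∈ Icc 0 T, ‖G s‖ ≤ K * (A * Real.exp (2 * K * s)) := fun s hs =>
    hG s hs _ fun r hr => (hgle r ⟨hr.1, hr.2.trans hs.2⟩).trans (by gcongr; exact hr.2)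
  have hI : ‖∫ s in (0:ℝ)..τ, G s‖ ≤ ∫ s in (0:ℝ)..τ, K * (A * Real.exp (2 * K * s)) :=
    intervalIntegral.norm_integral_le_of_norm_le hτ.1
      (ae_of_all _ fun s hs => hGle s ⟨hs.1.le, hs.2.trans hτ.2⟩)
      (Continuous.intervalIntegrable (by fun_prop) _ _)
  have h2 : ‖g τ‖ ≤ ‖g₀‖ + A / 2 * Real.exp (2 * K * τ) := by
    rw [hint τ hτ]
    exact (norm_add_le _ _).trans (add_le_add le_rfl (hI.trans (integral_exp_mul_le hA0)))
  have h3 : ‖g τ‖ = A * Real.exp (2 * K * τ) := by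
    rw [hA, mul_right_comm, ← Real.exp_add]; simp
  have h4 : 1 ≤ Real.exp (2 * K * τ) := Real.one_le_exp (by have := hτ.1; positivity)
  have h5 : A ≤ 2 * ‖g₀‖ := by nlinarith
  calc ‖g t‖ ≤ A * Real.exp (2 * K * t) := hgle t ht
    _ ≤ 2 * ‖g₀‖ * Real.exp (2 * K * t) := by gcongr
    _ = _ := by ring

/-- Global existence for a causal functional differential equation in integral form, for a bounded
right-hand side which is Lipschitz with respect to running suprema. -/
theorem exists_volterra_of_lipschitz [NormedSpace ℝ E] [CompleteSpace E]
    {F : (ℝ → E) → ℝ → E} {K B : ℝ} (hK : 0 < K)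
    (hmeas : ∀ ξ, Continuous ξ → AEStronglyMeasurable (F ξ) volume)
    (hB : ∀ ξ, Continuous ξ → ∀ t, 0 ≤ t → ‖F ξ t‖ ≤ B)
    (hF : ∀ ξ ξ', Continuous ξ → Continuous ξ' → ∀ t, 0 ≤ t → ∀ d,
      (∀ s ∈ Icc 0 t, ‖ξ s - ξ' s‖ ≤ d) → ‖F ξ t - F ξ' t‖ ≤ K * d) (ξ₀ : E) :
    ∃ ξ, Continuous ξ ∧ ∀ t, 0 ≤ t → ξ t = ξ₀ + ∫ s in (0:ℝ)..t, F ξ s := by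
  have hB0 : 0 ≤ B := (norm_nonneg _).trans (hB (fun _ => 0) continuous_const 0 le_rfl)
  have hii : ∀ ξ, Continuous ξ → ∀ t, 0 ≤ t → IntervalIntegrable (F ξ) volume 0 t :=
    fun ξ hξ t ht => by
    rw [intervalIntegrable_iff_integrableOn_Ioc_of_le ht]
    exact Measure.integrableOn_of_bounded (M := B) (by simp) (hmeas ξ hξ)
      ((ae_restrict_iff' measurableSet_Ioc).2 (ae_of_all _ fun s hs => hB ξ hξ s hs.1.le))
  have hIB : ∀ ξ, Continuous ξ → ∀ t, 0 ≤ t → ‖∫ s in (0:ℝ)..t, F ξ s‖ ≤ B * t :=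
    fun ξ hξ t ht => by
    have := intervalIntegral.norm_integral_le_of_norm_le_const (a := 0) (b := t) (C := B)
      (f := F ξ) fun s hs => hB ξ hξ s (by rw [uIoc_of_le ht] at hs; exact hs.1.le)
    rwa [sub_zero, abs_of_nonneg ht] at this
  have hIc : ∀ ξ, Continuous ξ → Continuous fun t : ℝ => ∫ s in (0:ℝ)..(max t 0), F ξ s := by
    intro ξ hξ
    refine (LipschitzWith.of_dist_le_mul (K := B.toNNReal) fun t t' => ?_).continuous
    rw [dist_eq_norm, intervalIntegral.integral_interval_sub_left (hii ξ hξ _ (le_max_right _ _))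
      (hii ξ hξ _ (le_max_right _ _)), Real.coe_toNNReal _ hB0]
    refine (intervalIntegral.norm_integral_le_of_norm_le_const (C := B) fun s hs => ?_).trans ?_
    · refine hB ξ hξ s (le_trans ?_ hs.1.le)
      exact le_min (le_max_right _ _) (le_max_right _ _)
    · gcongr
      rw [Real.dist_eq]
      exact abs_max_sub_max_le_abs _ _ _
  let lift : BoundedContinuousFunction ℝ E → ℝ → E := fun η t => Real.exp (2 * K * max t 0) • η t
  have hlift : ∀ η, Continuous (lift η) := fun η => by
    have := η.continuous
    fun_prop
  let Ψ : BoundedContinuousFunction ℝ E → BoundedContinuousFunction ℝ E := fun η =>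
    BoundedContinuousFunction.ofNormedAddCommGroup
      (fun t => Real.exp (-(2 * K * max t 0)) • (ξ₀ + ∫ s in (0:ℝ)..(max t 0), F (lift η) s))
      (by have := hIc _ (hlift η); fun_prop) (‖ξ₀‖ + B / (2 * K)) (by
        intro t
        have h0 : 0 ≤ max t 0 := le_max_right _ _
        set a := max t 0
        rw [norm_smul, Real.norm_of_nonneg (Real.exp_pos _).le]
        have h1 := (norm_add_le ξ₀ _).trans (add_le_add le_rfl (hIB _ (hlift η) a h0))
        have h2 : Real.exp (-(2 * K * a)) * Real.exp (2 * K * a) = 1 := by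
          rw [← Real.exp_add]; simp
        have h3 : 2 * K * a ≤ Real.exp (2 * K * a) := by
          have := Real.add_one_le_exp (2 * K * a); linarith
        have h4 : Real.exp (-(2 * K * a)) ≤ 1 := Real.exp_le_one_iff.2 (by
          have : 0 ≤ 2 * K * a := by positivity
          linarith)
        have h5 : Real.exp (-(2 * K * a)) * (2 * K * a) ≤ 1 := by
          rw [← h2]; gcongr
        calc _ ≤ Real.exp (-(2 * K * a)) * (‖ξ₀‖ + B * a) := by gcongr
          _ = Real.exp (-(2 * K * a)) * ‖ξ₀‖
              + B / (2 * K) * (Real.exp (-(2 * K * a)) * (2 * K * a)) := by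
            field_simp
          _ ≤ 1 * ‖ξ₀‖ + B / (2 * K) * 1 := by gcongr
          _ = _ := by ring)
  have hΨ : ∀ η t, Ψ η t =
    Real.exp (-(2 * K * max t 0)) • (ξ₀ + ∫ s in (0:ℝ)..(max t 0), F (lift η) s) :=
    fun η t => rfl
  have hcontr : ContractingWith (1 / 2) Ψ := by
    refine ⟨by rw [← NNReal.coe_lt_coe]; norm_num, LipschitzWith.of_dist_le_mul fun η η' => ?_⟩
    rw [BoundedContinuousFunction.dist_le (by positivity)]
    intro t
    have h0 : 0 ≤ max t 0 := le_max_right _ _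
    rw [hΨ, hΨ, dist_eq_norm, ← smul_sub, add_sub_add_left_eq_sub,
      ← intervalIntegral.integral_sub (hii _ (hlift η) _ h0) (hii _ (hlift η') _ h0),
      norm_smul, Real.norm_of_nonneg (Real.exp_pos _).le]
    set a := max t 0
    have hdl : ∀ s, 0 ≤ s → ‖F (lift η) s - F (lift η') s‖
        ≤ K * (dist η η' * Real.exp (2 * K * s)) := fun s hs => by
      refine hF _ _ (hlift _) (hlift _) s hs _ fun r hr => ?_
      simp only [lift]
      rw [← smul_sub, norm_smul, Real.norm_of_nonneg (Real.exp_pos _).le, max_eq_left hr.1,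
        ← dist_eq_norm, mul_comm]
      gcongr
      · exact BoundedContinuousFunction.dist_coe_le_dist r
      · exact hr.2
    have h1 : ‖∫ s in (0:ℝ)..a, (F (lift η) s - F (lift η') s)‖
        ≤ ∫ s in (0:ℝ)..a, K * (dist η η' * Real.exp (2 * K * s)) :=
      intervalIntegral.norm_integral_le_of_norm_le h0 (ae_of_all _ fun s hs => hdl s hs.1.le)
        (Continuous.intervalIntegrable (by fun_prop) _ _)
    have h2 := h1.trans (integral_exp_mul_le (dist_nonneg (x := η) (y := η')))
    have h3 : Real.exp (-(2 * K * a)) * Real.exp (2 * K * a) = 1 := by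
      rw [← Real.exp_add]; simp
    calc _ ≤ Real.exp (-(2 * K * a)) * (dist η η' / 2 * Real.exp (2 * K * a)) := by gcongr
      _ = dist η η' / 2 * (Real.exp (-(2 * K * a)) * Real.exp (2 * K * a)) := by ring
      _ = _ := by rw [h3]; push_cast; ring
  let η := hcontr.fixedPoint Ψ
  have hη : Ψ η = η := hcontr.fixedPoint_isFixedPt
  refine ⟨lift η, hlift η, fun t ht => ?_⟩
  have h1 : lift η t = Real.exp (2 * K * max t 0) • Ψ η t := by rw [hη]
  rw [h1, hΨ, smul_smul, ← Real.exp_add, max_eq_left ht]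
  simp

/-- The right-hand side `F` is causal and locally Lipschitz with respect to running suprema. -/
def CausalLipschitz (F : (ℝ → E) → ℝ → E) (r K : ℝ) : Prop :=
  ∀ ξ ξ', Continuous ξ → Continuous ξ' → ∀ t, 0 ≤ t → ∀ d,
    (∀ s ∈ Icc 0 t, ‖ξ s‖ ≤ r ∧ ‖ξ' s‖ ≤ r ∧ ‖ξ s - ξ' s‖ ≤ d) → ‖F ξ t - F ξ' t‖ ≤ K * d

theorem CausalLipschitz.norm_le {F : (ℝ → E) → ℝ → E} {r K : ℝ} (hF : CausalLipschitz F r K)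
    (hF0 : ∀ t, 0 ≤ t → F 0 t = 0) {ξ : ℝ → E} (hξ : Continuous ξ) {t d : ℝ} (ht : 0 ≤ t)
    (hd : d ≤ r) (h : ∀ s ∈ Icc 0 t, ‖ξ s‖ ≤ d) : ‖F ξ t‖ ≤ K * d := by
  have hd0 : 0 ≤ d := (norm_nonneg _).trans (h 0 ⟨le_rfl, ht⟩)
  have := hF ξ 0 hξ continuous_zero t ht d fun s hs =>
    ⟨(h s hs).trans hd, by simpa using hd0.trans hd, by simpa using h s hs⟩
  simpa [hF0 t ht] using this

theorem CausalLipschitz.intervalIntegrable {F : (ℝ → E) → ℝ → E} {r K : ℝ}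
    (hF : CausalLipschitz F r K) (hF0 : ∀ t, 0 ≤ t → F 0 t = 0)
    (hmeas : ∀ ξ, Continuous ξ → AEStronglyMeasurable (F ξ) volume)
    {ξ : ℝ → E} (hξ : Continuous ξ) {t : ℝ} (ht : 0 ≤ t)
    (h : ∀ s ∈ Icc 0 t, ‖ξ s‖ ≤ r) : IntervalIntegrable (F ξ) volume 0 t := by
  rw [intervalIntegrable_iff_integrableOn_Ioc_of_le ht]
  exact Measure.integrableOn_of_bounded (M := K * r) (by simp) (hmeas ξ hξ)
    ((ae_restrict_iff' measurableSet_Ioc).2 (ae_of_all _ fun s hs =>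
      hF.norm_le hF0 hξ hs.1.le le_rfl fun q hq => h q ⟨hq.1, hq.2.trans hs.2⟩))

theorem exists_bound_Icc {ξ : ℝ → E} (hξ : Continuous ξ) (T : ℝ) :
    ∃ r, ∀ s ∈ Icc 0 T, ‖ξ s‖ ≤ r :=
  isCompact_Icc.exists_bound_of_continuousOn hξ.continuousOn

theorem volterra_unique [NormedSpace ℝ E] {F : (ℝ → E) → ℝ → E}
    (hF : ∀ r, ∃ K, 0 < K ∧ CausalLipschitz F r K) (hF0 : ∀ t, 0 ≤ t → F 0 t = 0)
    (hmeas : ∀ ξ, Continuous ξ → AEStronglyMeasurable (F ξ) volume)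
    {ξ ξ' : ℝ → E} {ξ₀ : E} (hξ : Continuous ξ) (hξ' : Continuous ξ')
    (h : ∀ t, 0 ≤ t → ξ t = ξ₀ + ∫ s in (0:ℝ)..t, F ξ s)
    (h' : ∀ t, 0 ≤ t → ξ' t = ξ₀ + ∫ s in (0:ℝ)..t, F ξ' s) :
    ∀ t, 0 ≤ t → ξ t = ξ' t := by
  intro T hT
  obtain ⟨r₁, hr₁⟩ := exists_bound_Icc hξ T
  obtain ⟨r₂, hr₂⟩ := exists_bound_Icc hξ' T
  have b₁ : ∀ s ∈ Icc 0 T, ‖ξ s‖ ≤ max r₁ r₂ := fun s hs => (hr₁ s hs).trans (le_max_left _ _)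
  have b₂ : ∀ s ∈ Icc 0 T, ‖ξ' s‖ ≤ max r₁ r₂ := fun s hs => (hr₂ s hs).trans (le_max_right _ _)
  obtain ⟨K, hK, hKF⟩ := hF (max r₁ r₂)
  have key := norm_le_exp_of_causal_bound (T := T) hK (g := fun t => ξ t - ξ' t)
    (G := fun t => F ξ t - F ξ' t) (g₀ := 0) (by fun_prop) (fun t ht => by
      rw [h t ht.1, h' t ht.1, intervalIntegral.integral_sub]
      · abel
      · exact hKF.intervalIntegrable hF0 hmeas hξ ht.1 fun s hs => b₁ s ⟨hs.1, hs.2.trans ht.2⟩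
      · exact hKF.intervalIntegrable hF0 hmeas hξ' ht.1 fun s hs => b₂ s ⟨hs.1, hs.2.trans ht.2⟩)
    (fun t ht d hd => hKF ξ ξ' hξ hξ' t ht.1 d fun s hs =>
      ⟨b₁ s ⟨hs.1, hs.2.trans ht.2⟩, b₂ s ⟨hs.1, hs.2.trans ht.2⟩, hd s hs⟩) T ⟨hT, le_rfl⟩
  simpa [sub_eq_zero] using key

/-- Global existence for a causal functional differential equation whose solutions obey an a priori
bound. -/
theorem exists_volterra_of_apriori [NormedSpace ℝ E] [FiniteDimensional ℝ E] {F : (ℝ → E) → ℝ → E}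
    (hF : ∀ r, ∃ K, 0 < K ∧ CausalLipschitz F r K) (hF0 : ∀ t, 0 ≤ t → F 0 t = 0)
    (hmeas : ∀ ξ, Continuous ξ → AEStronglyMeasurable (F ξ) volume) {ξ₀ : E} {r : ℝ}
    (hr : ∀ T, 0 ≤ T → ∀ ξ, Continuous ξ →
      (∀ t ∈ Icc 0 T, ξ t = ξ₀ + ∫ s in (0:ℝ)..t, F ξ s) → ∀ t ∈ Icc 0 T, ‖ξ t‖ ≤ r) :
    ∃ ξ, Continuous ξ ∧ ∀ t, 0 ≤ t → ξ t = ξ₀ + ∫ s in (0:ℝ)..t, F ξ s := by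
  have hξ₀ : ‖ξ₀‖ ≤ r := hr 0 le_rfl (fun _ => ξ₀) continuous_const
    (fun t ht => by simp [le_antisymm ht.2 ht.1]) 0 ⟨le_rfl, le_rfl⟩
  have hr0 : 0 ≤ r := (norm_nonneg _).trans hξ₀
  let χ : ContDiffBump (0 : E) := ⟨r + 1, r + 2, by linarith, by linarith⟩
  let ρ : E → E := fun v => χ v • v
  have hρc : ContDiff ℝ 1 ρ := χ.contDiff.smul contDiff_id
  have hρs : HasCompactSupport ρ := χ.hasCompactSupport.smul_right
  obtain ⟨C, hC⟩ := hρc.lipschitzWith_of_hasCompactSupport hρs (by simp)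
  have hρr : ∀ v, ‖ρ v‖ ≤ r + 2 := fun v => by
    by_cases hv : ‖v‖ < r + 2
    · simp only [ρ, norm_smul, Real.norm_of_nonneg (χ.nonneg' v)]
      nlinarith [χ.le_one (x := v), χ.nonneg' v, norm_nonneg v]
    · have : χ v = 0 := χ.zero_of_le_dist (by simpa [χ] using hv)
      simp [ρ, this]; linarith
  have hρ1 : ∀ v, ‖v‖ ≤ r + 1 → ρ v = v := fun v hv => by
    simp only [ρ]
    rw [χ.one_of_mem_closedBall (by simpa [χ] using hv), one_smul]
  obtain ⟨K, hK, hKF⟩ := hF (r + 2)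
  have hρξ : ∀ {ξ : ℝ → E}, Continuous ξ → Continuous fun t => ρ (ξ t) := fun h =>
    hρc.continuous.comp h
  obtain ⟨ξ, hξ, hsol⟩ := exists_volterra_of_lipschitz (F := fun ξ => F fun t => ρ (ξ t))
    (K := K * (C + 1)) (B := K * (r + 2)) (by positivity) (fun ξ h => hmeas _ (hρξ h))
    (fun ξ h t ht => hKF.norm_le hF0 (hρξ h) ht le_rfl fun s _ => hρr _)
    (fun ξ ξ' h h' t ht d hd => by
      rw [mul_assoc]
      refine hKF _ _ (hρξ h) (hρξ h') t ht _ fun s hs => ⟨hρr _, hρr _, ?_⟩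
      refine (hC.norm_sub_le _ _).trans ?_
      have := hd s hs
      have := norm_nonneg (ξ s - ξ' s)
      have := C.coe_nonneg
      nlinarith) ξ₀
  have hcongr : ∀ T, 0 ≤ T → (∀ t ∈ Icc 0 T, ‖ξ t‖ ≤ r + 1) →
      ∀ t ∈ Icc 0 T, ξ t = ξ₀ + ∫ s in (0:ℝ)..t, F ξ s := fun T hT hb t ht => by
    rw [hsol t ht.1]
    congr 1
    refine intervalIntegral.integral_congr fun s hs => ?_
    rw [uIcc_of_le ht.1] at hs
    have := hKF _ _ (hρξ hξ) hξ s hs.1 0 fun q hq => by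
      have := hb q ⟨hq.1, hq.2.trans (hs.2.trans ht.2)⟩
      exact ⟨hρr _, by linarith, by simp [hρ1 _ this]⟩
    simpa [sub_eq_zero] using this
  have hbound : ∀ t, 0 ≤ t → ‖ξ t‖ ≤ r := by
    by_contra! hcon
    obtain ⟨t₁, ht₁, hlt⟩ := hcon
    have hcomp : IsCompact (Icc 0 t₁ ∩ {t | min ‖ξ t₁‖ (r + 1) ≤ ‖ξ t‖}) :=
      isCompact_Icc.inter_right (isClosed_le (by fun_prop) (by fun_prop))
    obtain ⟨t₂, ⟨ht₂, hge⟩, hleast⟩ := hcomp.exists_isLeast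
      ⟨t₁, ⟨ht₁, le_rfl⟩, by simp⟩
    have hr2 : r < min ‖ξ t₁‖ (r + 1) := lt_min hlt (by linarith)
    have hbefore : ∀ t ∈ Ico 0 t₂, ‖ξ t‖ ≤ r := fun t ht => by
      refine hr t ht.1 ξ hξ (hcongr t ht.1 fun s hs => ?_) t ⟨ht.1, le_rfl⟩
      by_contra! hs'
      have := hleast ⟨⟨hs.1, hs.2.trans (ht.2.le.trans ht₂.2)⟩, (min_le_right _ _).trans hs'.le⟩
      linarith [hs.2, ht.2]
    have hpos : 0 < t₂ := by
      rcases ht₂.1.eq_or_lt with h0 | h0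
      · have : ξ 0 = ξ₀ := by simpa using hsol 0 le_rfl
        rw [mem_ofPred_eq, ← h0, this] at hge
        linarith
      · exact h0
    have hlim : ‖ξ t₂‖ ≤ r := by
      refine le_of_tendsto (x := 𝓝[<] t₂) (hξ.norm.continuousAt.tendsto.mono_left
        nhdsWithin_le_nhds) ?_
      filter_upwards [Ico_mem_nhdsLT hpos] with t ht using hbefore t ht
    exact absurd (hge.trans hlim) (not_le.2 hr2)
  exact ⟨ξ, hξ, fun t ht => hcongr t ht (fun s hs => (hbound s hs.1).trans (by linarith)) t
    ⟨ht, le_rfl⟩⟩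

end Volterra

section Comparison

theorem le_of_right_deriv_nonpos {v v' : ℝ → ℝ} {s T r : ℝ} (hv : ContinuousOn v (Icc s T))
    (hv' : ∀ t ∈ Ico s T, HasDerivWithinAt v (v' t) (Ici t) t)
    (h : ∀ t ∈ Ico s T, r < v t → v' t ≤ 0) (hs : v s ≤ r) : ∀ t ∈ Icc s T, v t ≤ r := by
  intro t ht
  have key : ∀ ε > 0, v t ≤ r + ε * (1 + (t - s)) := fun ε hε =>
    image_le_of_deriv_right_lt_deriv_boundary hv hv' (B := fun t => r + ε * (1 + (t - s)))
      (B' := fun _ => ε) (by simp; linarith)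
      (fun x => by
        have h1 : HasDerivAt (fun t : ℝ => 1 + (t - s)) 1 x :=
          ((hasDerivAt_id x).sub_const s).const_add 1
        simpa using (h1.const_mul ε).const_add r)
      (fun x hx hxe => by
        have : 0 ≤ x - s := sub_nonneg.2 hx.1
        have := h x hx (by rw [hxe]; nlinarith)
        linarith) ht
  refine le_of_forall_pos_le_add fun ε hε => ?_
  have h1 : 0 < 1 + (t - s) := by linarith [ht.1]
  have := key (ε / (1 + (t - s))) (by positivity)
  rwa [div_mul_cancel₀ _ h1.ne'] at this

/-- A function which decreases at rate at least `δ` above the level `r`. -/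
theorem le_max_of_right_deriv_le_neg {v v' : ℝ → ℝ} {T r δ : ℝ} (hδ : 0 ≤ δ)
    (hv : ContinuousOn v (Icc 0 T)) (hv' : ∀ t ∈ Ico 0 T, HasDerivWithinAt v (v' t) (Ici t) t)
    (h : ∀ t ∈ Ico 0 T, r < v t → v' t ≤ -δ) : ∀ t ∈ Icc 0 T, v t ≤ max r (v 0 - δ * t) := by
  intro t ht
  by_cases hex : ∃ s ∈ Icc 0 t, v s ≤ r
  · obtain ⟨s, hs, hsr⟩ := hex
    exact (le_of_right_deriv_nonpos (hv.mono (Icc_subset_Icc_left hs.1))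
      (fun q hq => hv' q ⟨hs.1.trans hq.1, hq.2⟩)
      (fun q hq hr => (h q ⟨hs.1.trans hq.1, hq.2⟩ hr).trans (by linarith)) hsr t
      ⟨hs.2, ht.2⟩).trans (le_max_left _ _)
  · push Not at hex
    refine le_trans ?_ (le_max_right _ _)
    refine image_le_of_deriv_right_le_deriv_boundary (hv.mono (Icc_subset_Icc_right ht.2))
      (fun q hq => hv' q ⟨hq.1, hq.2.trans_le ht.2⟩) (B := fun q => v 0 - δ * q)
      (B' := fun _ => -δ) (by simp) (by fun_prop) (fun q _ => ?_)
      (fun q hq => h q ⟨hq.1, hq.2.trans_le ht.2⟩ (hex q ⟨hq.1, hq.2.le⟩)) ⟨ht.1, le_rfl⟩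
    simpa using (((hasDerivAt_id q).const_mul δ).const_sub (v 0)).hasDerivWithinAt

/-- Halanay's inequality with unit delay. -/
theorem halanay {y y' : ℝ → ℝ} {T₁ α β σ M : ℝ} (hσ : 0 < σ) (hσα : 2 * σ ≤ α)
    (hβα : 4 * (β * Real.exp σ) ≤ α) (hy0 : ∀ t, T₁ ≤ t → 0 ≤ y t)
    (hy : ContinuousOn y (Ici T₁))
    (hy' : ∀ t, T₁ + 1 ≤ t → HasDerivWithinAt y (y' t) (Ici t) t)
    (hbound : ∀ t, T₁ + 1 ≤ t → ∀ N, (∀ s ∈ Icc (t - 1) t, y s ≤ N) → y' t ≤ -α * y t + β * N)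
    (hM : ∀ t ∈ Icc T₁ (T₁ + 1), y t ≤ M) :
    ∀ t, T₁ ≤ t → y t ≤ M * Real.exp (-σ * (t - (T₁ + 1))) := by
  intro T hT
  obtain ⟨τ, hτ, hmax⟩ := isCompact_Icc.exists_isMaxOn (s := Icc T₁ T) ⟨T, hT, le_rfl⟩
    (f := fun t => Real.exp (σ * (t - (T₁ + 1))) * y t)
    (by have := hy.mono (Icc_subset_Ici_self : Icc T₁ T ⊆ _); fun_prop)
  set A := Real.exp (σ * (τ - (T₁ + 1))) * y τ with hA
  have hA0 : 0 ≤ A := mul_nonneg (Real.exp_pos _).le (hy0 τ hτ.1)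
  have hM0 : 0 ≤ M := (hy0 T₁ le_rfl).trans (hM T₁ ⟨le_rfl, by linarith⟩)
  have hcancel : ∀ s, Real.exp (σ * (s - (T₁ + 1))) * Real.exp (-σ * (s - (T₁ + 1))) = 1 :=
    fun s => by rw [← Real.exp_add]; simp
  have hyA : ∀ s ∈ Icc T₁ T, y s ≤ A * Real.exp (-σ * (s - (T₁ + 1))) := fun s hs => by
    have h1 : Real.exp (σ * (s - (T₁ + 1))) * y s ≤ A := hmax hs
    calc y s = Real.exp (σ * (s - (T₁ + 1))) * y s * Real.exp (-σ * (s - (T₁ + 1))) := by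
          rw [mul_right_comm, hcancel, one_mul]
      _ ≤ _ := by gcongr
  suffices hAM : A ≤ M from (hyA T ⟨hT, le_rfl⟩).trans (by gcongr)
  have hτA : y τ = A * Real.exp (-σ * (τ - (T₁ + 1))) := by
    rw [hA, mul_right_comm, hcancel, one_mul]
  rcases le_total τ (T₁ + 1) with hτ1 | hτ1
  · calc A ≤ 1 * M := mul_le_mul (Real.exp_le_one_iff.2 (by nlinarith)) (hM τ ⟨hτ.1, hτ1⟩)
          (hy0 τ hτ.1) zero_le_one
      _ = M := one_mul M
  · have hbar : ∀ N, M ≤ N → A / 2 < N → A ≤ N := by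
      intro N hMN hAN
      have hle : y τ ≤ N * Real.exp (-σ * (τ - (T₁ + 1))) := by
        refine image_le_of_deriv_right_lt_deriv_boundary (a := T₁ + 1) (b := τ)
          (hy.mono fun s hs => le_trans (by linarith) hs.1) (fun s hs => hy' s hs.1)
          (B := fun s => N * Real.exp (-σ * (s - (T₁ + 1))))
          (B' := fun s => N * (Real.exp (-σ * (s - (T₁ + 1))) * -σ)) ?_ (fun s => ?_)
          (fun s hs hse => ?_) ⟨hτ1, le_rfl⟩
        · simpa using (hM _ ⟨by linarith, le_rfl⟩).trans hMN
        · have h1 : HasDerivAt (fun s : ℝ => -σ * (s - (T₁ + 1))) (-σ) s := by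
            simpa using ((hasDerivAt_id s).sub_const (T₁ + 1)).const_mul (-σ)
          exact h1.exp.const_mul N
        · have hb := hbound s hs.1 (A * (Real.exp σ * Real.exp (-σ * (s - (T₁ + 1)))))
            fun q hq => by
              refine (hyA q ⟨by linarith [hq.1, hs.1], by linarith [hq.2, hs.2, hτ.2]⟩).trans ?_
              rw [← Real.exp_add]
              gcongr
              nlinarith [hq.1]
          rw [hse] at hb
          have hE := Real.exp_pos (-σ * (s - (T₁ + 1)))
          set E := Real.exp (-σ * (s - (T₁ + 1)))
          have hN : 0 < N := by linarith
          have h1 : β * Real.exp σ * A ≤ α / 4 * A := by gcongr; linarith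
          have h2 : σ * N ≤ α / 2 * N := by gcongr; linarith
          have h3 : 0 < α := by linarith
          have h4 : α / 4 * A < α / 2 * N := by nlinarith
          nlinarith
      rw [hτA] at hle
      exact le_of_mul_le_mul_right hle (Real.exp_pos _)
    by_contra! hlt
    have := hbar (max M (3 * A / 4)) (le_max_left _ _)
      (lt_of_lt_of_le (by linarith) (le_max_right _ _))
    rcases le_max_iff.1 this with h1 | h1 <;> linarith

end Comparison

section KInfinity

/-- A locally Lipschitz class `K∞` majorant of `s ↦ Γ ⌈s⌉₊ * s`. -/
theorem exists_kInfinity_majorant (Γ : ℕ → ℝ) :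
    ∃ C : ℝ → ℝ, (C 0 = 0 ∧ StrictMonoOn C (Ici 0) ∧ ContinuousOn C (Ici 0) ∧
      Tendsto C atTop atTop ∧ LocallyLipschitz C) ∧ ∀ s, 0 ≤ s → Γ ⌈s⌉₊ * s ≤ C s := by
  let g : ℝ → ℝ := fun s => ∑ i ∈ Finset.range (⌈s⌉₊ + 1), |Γ i|
  have hg0 : ∀ s, 0 ≤ g s := fun s => Finset.sum_nonneg fun _ _ => abs_nonneg _
  have hgm : Monotone g := fun s s' hs =>
    Finset.sum_le_sum_of_subset_of_nonneg
      (Finset.range_mono (Nat.add_le_add_right (Nat.ceil_mono hs) 1)) fun _ _ _ => abs_nonneg _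
  have hgi : ∀ a b, IntervalIntegrable g volume a b := fun a b => hgm.intervalIntegrable
  have hsub : ∀ a b, (∫ r in (0:ℝ)..b, g r) - ∫ r in (0:ℝ)..a, g r = ∫ r in a..b, g r :=
    fun a b => intervalIntegral.integral_interval_sub_left (hgi _ _) (hgi _ _)
  let C : ℝ → ℝ := fun s => s + ∫ r in (0:ℝ)..(2 * s), g r
  have hCs : StrictMono C := fun a b hab => by
    have h1 := hsub (2 * a) (2 * b)
    have h2 : 0 ≤ ∫ r in (2 * a)..(2 * b), g r :=
      intervalIntegral.integral_nonneg (by linarith) fun r _ => hg0 r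
    simp only [C]; linarith
  have hCl : LocallyLipschitz C := by
    intro x
    refine ⟨(1 + 2 * g (2 * (x + 1))).toNNReal, Metric.ball x 1,
      Metric.ball_mem_nhds x one_pos, LipschitzOnWith.of_dist_le_mul fun a ha b hb => ?_⟩
    have hK : 0 ≤ 1 + 2 * g (2 * (x + 1)) := by linarith [hg0 (2 * (x + 1))]
    rw [Real.coe_toNNReal _ hK, Real.dist_eq, Real.dist_eq]
    have h1 : C a - C b = (a - b) + ∫ r in (2 * b)..(2 * a), g r := by
      rw [← hsub]; simp only [C]; ring
    rw [Metric.mem_ball, Real.dist_eq, abs_lt] at ha hb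
    have h2 : ‖∫ r in (2 * b)..(2 * a), g r‖ ≤ g (2 * (x + 1)) * |2 * a - 2 * b| :=
      intervalIntegral.norm_integral_le_of_norm_le_const fun r hr => by
        rw [Real.norm_of_nonneg (hg0 r)]
        refine hgm (hr.2.trans (max_le ?_ ?_)) <;> linarith
    rw [h1]
    refine (abs_add_le _ _).trans ?_
    rw [Real.norm_eq_abs, ← mul_sub, abs_mul, abs_two] at h2
    linarith
  refine ⟨C, ⟨by simp [C], hCs.strictMonoOn _, hCl.continuous.continuousOn, ?_, hCl⟩,
    fun s hs => ?_⟩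
  · refine tendsto_atTop_mono' _ ?_ tendsto_id
    filter_upwards [eventually_ge_atTop 0] with s hs
    have : 0 ≤ ∫ r in (0:ℝ)..(2 * s), g r :=
      intervalIntegral.integral_nonneg (by linarith) fun r _ => hg0 r
    simp only [C, id]; linarith
  · have h1 : ∫ r in s..(2 * s), g s ≤ ∫ r in s..(2 * s), g r :=
      intervalIntegral.integral_mono_on (by linarith) intervalIntegrable_const (hgi _ _)
        fun r hr => hgm hr.1
    have h2 : 0 ≤ ∫ r in (0:ℝ)..s, g r := intervalIntegral.integral_nonneg hs fun r _ => hg0 r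
    have h3 := hsub s (2 * s)
    have h4 : Γ ⌈s⌉₊ ≤ g s := (le_abs_self _).trans
      (Finset.single_le_sum (f := fun i => |Γ i|) (fun _ _ => abs_nonneg _)
        (Finset.self_mem_range_succ _))
    have h5 : Γ ⌈s⌉₊ * s ≤ g s * s := by gcongr
    rw [intervalIntegral.integral_const, smul_eq_mul] at h1
    simp only [C]
    nlinarith

end KInfinity

section Partition

/-- The index of the cell `[π i, π (i + 1))` of a partition which contains `t`. -/
noncomputable def cellIdx (π : ℕ → ℝ) (t : ℝ) : ℕ := sInf {i | t < π (i + 1)}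

structure IsPartition (π : ℕ → ℝ) : Prop where
  zero : π 0 = 0
  strictMono : StrictMono π
  tendsto : Tendsto π atTop atTop

variable {π : ℕ → ℝ}

theorem IsPartition.lt_succ (hπ : IsPartition π) (t : ℝ) : t < π (cellIdx π t + 1) := by
  have hne : {i | t < π (i + 1)}.Nonempty := by
    obtain ⟨i, hi⟩ := (hπ.tendsto.eventually_gt_atTop t).exists
    exact ⟨i, hi.trans (hπ.strictMono (Nat.lt_succ_self i))⟩
  exact Nat.sInf_mem hne

theorem IsPartition.le_self (hπ : IsPartition π) {t : ℝ} (ht : 0 ≤ t) : π (cellIdx π t) ≤ t := by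
  rcases h : cellIdx π t with _ | i
  · rwa [hπ.zero]
  · by_contra! hlt
    have : cellIdx π t ≤ i := Nat.sInf_le hlt
    omega

theorem IsPartition.nonneg (hπ : IsPartition π) (i : ℕ) : 0 ≤ π i :=
  hπ.zero ▸ hπ.strictMono.monotone (Nat.zero_le i)

theorem IsPartition.cellIdx_eq (hπ : IsPartition π) {t : ℝ} {i : ℕ}
    (ht : t ∈ Ico (π i) (π (i + 1))) :
    cellIdx π t = i := by
  refine le_antisymm (Nat.sInf_le ht.2) ?_
  by_contra! hlt
  exact absurd (hπ.lt_succ t) (not_lt.2 ((hπ.strictMono.monotone hlt).trans ht.1))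

theorem IsPartition.cellIdx_mono (hπ : IsPartition π) : Monotone (cellIdx π) := fun _ t hst =>
  Nat.sInf_le (hst.trans_lt (hπ.lt_succ t))

theorem IsPartition.eventually_cellIdx (hπ : IsPartition π) {t : ℝ} (ht : 0 ≤ t) :
    ∀ᶠ s in 𝓝[≥] t, cellIdx π s = cellIdx π t := by
  filter_upwards [Ico_mem_nhdsGE (hπ.lt_succ t)] with s hs
  exact hπ.cellIdx_eq ⟨(hπ.le_self ht).trans hs.1, hs.2⟩

end Partition

section Lipschitz

theorem LocallyLipschitzOn.exists_norm_sub_le {A B : Type*} [SeminormedAddCommGroup A]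
    [SeminormedAddCommGroup B] {G : A → B} {s : Set A} (hG : LocallyLipschitzOn s G)
    (hs : IsCompact s) : ∃ K : ℝ, 0 ≤ K ∧ ∀ a ∈ s, ∀ b ∈ s, ‖G a - G b‖ ≤ K * ‖a - b‖ := by
  obtain ⟨K, hK⟩ := hG.exists_lipschitzOnWith_of_compact hs
  exact ⟨K, K.coe_nonneg, fun a ha b hb => hK.norm_sub_le ha hb⟩

/-- `f` is Lipschitz in a neighbourhood of `x`. -/
def LipschitzNear {A B : Type*} [PseudoEMetricSpace A] [PseudoEMetricSpace B] (f : A → B)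
    (x : A) : Prop := ∃ K, ∃ t ∈ 𝓝 x, LipschitzOnWith K f t

theorem LipschitzNear.continuousAt {A B : Type*} [PseudoEMetricSpace A] [PseudoEMetricSpace B]
    {f : A → B} {x : A} (hf : LipschitzNear f x) : ContinuousAt f x := by
  obtain ⟨K, t, ht, hK⟩ := hf
  exact hK.continuousOn.continuousAt ht

theorem LipschitzNear.comp {A B C : Type*} [PseudoEMetricSpace A] [PseudoEMetricSpace B]
    [PseudoEMetricSpace C] {g : B → C} {f : A → B} {x : A} (hg : LipschitzNear g (f x))
    (hf : LipschitzNear f x) : LipschitzNear (fun a => g (f a)) x := by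
  have hc := hf.continuousAt
  obtain ⟨K, t, ht, hK⟩ := hf
  obtain ⟨K', t', ht', hK'⟩ := hg
  exact ⟨K' * K, t ∩ f ⁻¹' t', inter_mem ht (hc ht'),
    hK'.comp (hK.mono inter_subset_left) fun a ha => ha.2⟩

theorem LipschitzNear.prodMk {A B C : Type*} [PseudoEMetricSpace A] [PseudoEMetricSpace B]
    [PseudoEMetricSpace C] {g : A → C} {f : A → B} {x : A} (hf : LipschitzNear f x)
    (hg : LipschitzNear g x) : LipschitzNear (fun a => (f a, g a)) x := by
  obtain ⟨K, t, ht, hK⟩ := hf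
  obtain ⟨K', t', ht', hK'⟩ := hg
  exact ⟨max K K', t ∩ t', inter_mem ht ht',
    (hK.mono inter_subset_left).prodMk (hK'.mono inter_subset_right)⟩

theorem ContDiffAt.lipschitzNear {A B : Type*} [NormedAddCommGroup A] [NormedSpace ℝ A]
    [NormedAddCommGroup B] [NormedSpace ℝ B] {f : A → B} {x : A} (hf : ContDiffAt ℝ 1 f x) :
    LipschitzNear f x := hf.exists_lipschitzOnWith

theorem contDiff_gradient {E : Type*} [NormedAddCommGroup E] [InnerProductSpace ℝ E]
    [CompleteSpace E] {V : E → ℝ} (hV : ContDiff ℝ 2 V) : ContDiff ℝ 1 (gradient V) :=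
  (InnerProductSpace.toDual ℝ E).symm.contDiff.comp (hV.fderiv_right (m := 1) le_rfl)

end Lipschitz

section Observer

variable {E U Y : Type*} [NormedAddCommGroup E] [InnerProductSpace ℝ E] [CompleteSpace E]
  [NormedAddCommGroup U] [NormedSpace ℝ U] [NormedAddCommGroup Y] [NormedSpace ℝ Y]

theorem observerGain_locallyLipschitzOn {f : E → U → E}
    (hf : ContDiff ℝ 1 (fun q : E × U => f q.1 q.2)) {S : Set U} {h : E → Y}
    (hh : ContDiff ℝ 1 h) {V : E → ℝ} (hV : ContDiff ℝ 2 V) {W : E → ℝ} (hW : ContDiff ℝ 1 W)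
    (hWpos : ∀ x ≠ 0, 0 < W x) {R : ℝ}
    (hH1 : ∀ x u, u ∈ S → R ≤ V x → ⟪gradient V x, f x u⟫ ≤ -W x)
    (hR0 : {x | V x ≤ R} ∈ 𝓝 (0 : E)) (hS : S.Nonempty) (L : Y →L[ℝ] E) {a : ℝ} (haR : R ≤ a)
    {p : ℝ → ℝ} (hp : LocallyLipschitz p) (hpa : ∀ s, s ≤ a → p s = 0)
    {φ : E → Y → U → ℝ} (hφ : ∀ z y u, φ z y u =
      max 0 (⟪gradient V z, f z u⟫ + W z + p (V z) * ⟪gradient V z, L (h z - y)⟫))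
    {khat : E → Y → U → E} (hkhat1 : ∀ z y u, V z ≤ R → khat z y u = L (h z - y))
    (hkhat2 : ∀ z y u, R < V z →
      khat z y u = L (h z - y) - (φ z y u / ‖gradient V z‖ ^ 2) • gradient V z) :
    LocallyLipschitzOn (univ ×ˢ univ ×ˢ S) (fun q : E × Y × U => khat q.1 q.2.1 q.2.2) := by
  rintro ⟨z₀, y₀, u₀⟩ hq₀
  have hg := contDiff_gradient hV
  have hlin : LipschitzNear (fun q : E × Y × U => L (h q.1 - q.2.1)) (z₀, y₀, u₀) :=
    ContDiffAt.lipschitzNear (ContDiff.contDiffAt (by fun_prop))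
  by_cases hloc : {z | V z ≤ R} ∈ 𝓝 z₀
  · obtain ⟨K, t, ht, hK⟩ := hlin
    refine ⟨K, t ∩ Prod.fst ⁻¹' {z | V z ≤ R}, mem_nhdsWithin_of_mem_nhds
      (inter_mem ht (continuous_fst.continuousAt hloc)), ?_⟩
    intro q hq q' hq'
    simp only [hkhat1 _ _ _ hq.2, hkhat1 _ _ _ hq'.2]
    exact hK hq.1 hq'.1
  have hz₀ : z₀ ≠ 0 := by rintro rfl; exact hloc hR0
  have hVz₀ : R ≤ V z₀ := by
    by_contra! hlt
    refine hloc ?_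
    filter_upwards [hV.continuous.continuousAt.eventually_lt continuousAt_const hlt] with z hz
    exact hz.le
  have hgz₀ : gradient V z₀ ≠ 0 := fun h0 => by
    obtain ⟨u, hu⟩ := hS
    have := hH1 z₀ u hu hVz₀
    rw [h0, inner_zero_left] at this
    linarith [hWpos z₀ hz₀]
  let g : E × Y × U → E := fun q =>
    φ q.1 q.2.1 q.2.2 • ((‖gradient V q.1‖ ^ 2)⁻¹ • gradient V q.1)
  have hφlip : LipschitzNear (fun q : E × Y × U => φ q.1 q.2.1 q.2.2) (z₀, y₀, u₀) := by
    have h1 : LipschitzNear (fun q : E × Y × U => ⟪gradient V q.1, f q.1 q.2.2⟫ + W q.1)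
        (z₀, y₀, u₀) := by
      refine ContDiffAt.lipschitzNear (ContDiff.contDiffAt ?_)
      have hf' : ContDiff ℝ 1 (fun q : E × Y × U => f q.1 q.2.2) :=
        hf.comp (contDiff_fst.prodMk contDiff_snd.snd)
      exact ((hg.comp contDiff_fst).inner ℝ hf').add (hW.comp contDiff_fst)
    have h2 : LipschitzNear (fun q : E × Y × U => ⟪gradient V q.1, L (h q.1 - q.2.1)⟫)
        (z₀, y₀, u₀) := by
      refine ContDiffAt.lipschitzNear (ContDiff.contDiffAt ?_)
      exact (hg.comp contDiff_fst).inner ℝ (by fun_prop)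
    have h3 : LipschitzNear (fun q : E × Y × U => p (V q.1)) (z₀, y₀, u₀) :=
      LipschitzNear.comp (g := p) (f := fun q : E × Y × U => V q.1) (hp _)
        (ContDiffAt.lipschitzNear (ContDiff.contDiffAt ((hV.of_le one_le_two).comp contDiff_fst)))
    have h4 : ∀ q, LipschitzNear (fun q : ℝ × ℝ × ℝ => q.1 + q.2.1 * q.2.2) q := fun q =>
      ContDiffAt.lipschitzNear (ContDiff.contDiffAt (by fun_prop))
    have h5 := LipschitzNear.comp (h4 _) (h1.prodMk (h3.prodMk h2))
    have h6 : ∀ s : ℝ, LipschitzNear (fun s : ℝ => max 0 s) s := fun s =>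
      ((LipschitzWith.id (α := ℝ)).const_max 0).locallyLipschitz s
    simp only [hφ]
    exact (h6 _).comp h5
  have hglip : LipschitzNear g (z₀, y₀, u₀) := by
    have h1 : LipschitzNear (fun q : E × Y × U => (‖gradient V q.1‖ ^ 2)⁻¹ • gradient V q.1)
        (z₀, y₀, u₀) := by
      refine ContDiffAt.lipschitzNear ?_
      have h2 : ContDiffAt ℝ 1 (fun q : E × Y × U => gradient V q.1) (z₀, y₀, u₀) :=
        (hg.comp contDiff_fst).contDiffAt
      exact ((h2.norm_sq ℝ).inv (by simpa using hgz₀)).smul h2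
    have h3 : ∀ q, LipschitzNear (fun q : ℝ × E => q.1 • q.2) q := fun q =>
      ContDiffAt.lipschitzNear (ContDiff.contDiffAt (by fun_prop))
    exact LipschitzNear.comp (h3 _) (hφlip.prodMk h1)
  let ψ : E × Y × U → E := fun q => L (h q.1 - q.2.1) - khat q.1 q.2.1 q.2.2
  have hψ1 : ∀ q, V q.1 ≤ R → ψ q = 0 := fun q hq => by simp [ψ, hkhat1 _ _ _ hq]
  have hψ2 : ∀ q, R < V q.1 → ψ q = g q := fun q hq => by
    simp [ψ, g, hkhat2 _ _ _ hq, smul_smul, div_eq_mul_inv]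
  have hg0 : ∀ q, V q.1 = R → q.2.2 ∈ S → g q = 0 := fun q hq hu => by
    have h1 := hH1 q.1 q.2.2 hu hq.ge
    have : φ q.1 q.2.1 q.2.2 = 0 := by
      rw [hφ, hpa _ (hq.le.trans haR), zero_mul, add_zero, max_eq_left (by linarith)]
    simp [g, this]
  obtain ⟨K, t, ht, hK⟩ := hglip
  obtain ⟨ε, hε, hball⟩ := Metric.mem_nhds_iff.1 ht
  have hmixed : ∀ q ∈ Metric.ball (z₀, y₀, u₀) ε, ∀ q' ∈ Metric.ball (z₀, y₀, u₀) ε,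
      q.2.2 ∈ S → R < V q.1 → V q'.1 ≤ R → ‖ψ q‖ ≤ K * dist q q' := by
    intro q hq q' hq' hu hVq hVq'
    have hzs : q.1 ∈ Metric.ball z₀ ε ∧ q'.1 ∈ Metric.ball z₀ ε :=
      ⟨Metric.mem_ball.2 (lt_of_le_of_lt (le_max_left _ _) (Metric.mem_ball.1 hq)),
        Metric.mem_ball.2 (lt_of_le_of_lt (le_max_left _ _) (Metric.mem_ball.1 hq'))⟩
    obtain ⟨z, hz, hVz⟩ : R ∈ V '' segment ℝ q'.1 q.1 :=
      (convex_segment _ _).isPreconnected.intermediate_value (left_mem_segment ℝ _ _)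
        (right_mem_segment ℝ _ _) hV.continuous.continuousOn ⟨hVq', hVq.le⟩
    have hzb : z ∈ Metric.ball z₀ ε := (convex_ball z₀ ε).segment_subset hzs.2 hzs.1 hz
    have hqz : (z, q.2) ∈ Metric.ball (z₀, y₀, u₀) ε :=
      Metric.mem_ball.2 (max_lt (Metric.mem_ball.1 hzb)
        (lt_of_le_of_lt (le_max_right _ _) (Metric.mem_ball.1 hq)))
    have h1 : dist (g q) (g (z, q.2)) ≤ K * dist q (z, q.2) :=
      hK.dist_le_mul _ (hball hq) _ (hball hqz)
    rw [hg0 (z, q.2) hVz hu, dist_zero_right] at h1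
    rw [hψ2 q hVq]
    refine h1.trans ?_
    gcongr
    rw [Prod.dist_eq]
    simp only [dist_self]
    rw [max_eq_left dist_nonneg]
    refine le_trans ?_ (le_max_left _ _)
    have := dist_add_dist_of_mem_segment hz
    rw [dist_comm q.1 z, dist_comm q.1 q'.1, ← this]
    linarith [dist_nonneg (x := q'.1) (y := z)]
  have hψlip : LipschitzOnWith K ψ (Metric.ball (z₀, y₀, u₀) ε ∩ univ ×ˢ univ ×ˢ S) := by
    refine LipschitzOnWith.of_dist_le_mul fun q hq q' hq' => ?_
    rcases le_or_gt (V q.1) R with h1 | h1 <;> rcases le_or_gt (V q'.1) R with h2 | h2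
    · rw [hψ1 q h1, hψ1 q' h2, dist_self]; positivity
    · rw [hψ1 q h1, dist_zero_left, dist_comm]
      exact hmixed q' hq'.1 q hq.1 hq'.2.2.2 h2 h1
    · rw [hψ1 q' h2, dist_zero_right]
      exact hmixed q hq.1 q' hq'.1 hq.2.2.2 h1 h2
    · rw [hψ2 q h1, hψ2 q' h2]
      exact hK.dist_le_mul _ (hball hq.1) _ (hball hq'.1)
  obtain ⟨K', t', ht', hK'⟩ := hlin
  refine ⟨K' + K, t' ∩ (Metric.ball (z₀, y₀, u₀) ε ∩ univ ×ˢ univ ×ˢ S), ?_, ?_⟩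
  · exact inter_mem (mem_nhdsWithin_of_mem_nhds ht') (inter_mem
      (mem_nhdsWithin_of_mem_nhds (Metric.ball_mem_nhds _ hε)) self_mem_nhdsWithin)
  · refine LipschitzOnWith.of_dist_le_mul fun q hq q' hq' => ?_
    have h1 := hK'.dist_le_mul q hq.1 q' hq'.1
    have h2 := hψlip.dist_le_mul q hq.2 q' hq'.2
    have h3 : ∀ q : E × Y × U, khat q.1 q.2.1 q.2.2 = L (h q.1 - q.2.1) - ψ q := fun q => by
      simp [ψ]
    rw [h3, h3]
    refine (dist_sub_sub_le _ _ _ _).trans ?_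
    push_cast
    linarith

end Observer

section ClosedLoop

variable {E U Y : Type*} [NormedAddCommGroup E] [NormedSpace ℝ E]
  [NormedAddCommGroup U] [NormedSpace ℝ U] [NormedAddCommGroup Y] [NormedSpace ℝ Y]

/-- The sample-and-hold input generated by the feedback `kc` along `z`. -/
noncomputable def holdInput (kc : E → U) (θ : ℕ → ℝ) (z : ℝ → E) (t : ℝ) : U :=
  kc (z (θ (cellIdx θ t)))

/-- The rate of change `∇h(z) f(z, u)` of the predicted output. -/
noncomputable def outputRate (f : E → U → E) (h : E → Y) (q : E × U) : Y :=
  fderiv ℝ h q.1 (f q.1 q.2)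

/-- The inter-sample predictor, reset at the sampling times. -/
noncomputable def predOutput (f : E → U → E) (h : E → Y) (π : ℕ → ℝ) (u : ℝ → U) (x z : ℝ → E)
    (t : ℝ) : Y :=
  h (x (π (cellIdx π t))) + ∫ s in (π (cellIdx π t))..t, outputRate f h (z s, u s)

/-- The right-hand side of the closed loop as a causal functional of the state `(x, z)`. -/
noncomputable def loopField (f : E → U → E) (h : E → Y) (khat : E → Y → U → E) (kc : E → U)
    (θ π : ℕ → ℝ) (ξ : ℝ → E × E) (t : ℝ) : E × E :=
  let u := holdInput kc θ fun s => (ξ s).2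
  let w := predOutput f h π u (fun s => (ξ s).1) fun s => (ξ s).2
  (f (ξ t).1 (u t), f (ξ t).2 (u t) + khat (ξ t).2 (w t) (u t))

/-- Regularity assumptions on the closed loop, with inputs constrained to the compact set `S`. -/
structure LoopRegular (f : E → U → E) (h : E → Y) (khat : E → Y → U → E) (kc : E → U)
    (S : Set U) : Prop where
  f_contDiff : ContDiff ℝ 1 (fun q : E × U => f q.1 q.2)
  rate_contDiff : ContDiff ℝ 1 (outputRate f h)
  h_contDiff : ContDiff ℝ 1 h
  f_zero : f 0 0 = 0
  h_zero : h 0 = 0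
  kc_lip : LocallyLipschitz kc
  kc_mem : ∀ x, kc x ∈ S
  kc_zero : kc 0 = 0
  isCompact : IsCompact S
  khat_lip : LocallyLipschitzOn (univ ×ˢ univ ×ˢ S) fun q : E × Y × U => khat q.1 q.2.1 q.2.2
  khat_zero : khat 0 0 0 = 0

theorem stronglyMeasurable_holdInput {A B : Type*} [TopologicalSpace B] {kc : A → B}
    {θ : ℕ → ℝ} (hθ : IsPartition θ) (z : ℝ → A) : StronglyMeasurable (holdInput kc θ z) :=
  (StronglyMeasurable.of_discrete (f := fun j => kc (z (θ j)))).comp_measurable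
    hθ.cellIdx_mono.measurable

namespace LoopRegular

variable {f : E → U → E} {h : E → Y} {khat : E → Y → U → E} {kc : E → U} {S : Set U}

theorem rate_intervalIntegrable (H : LoopRegular f h khat kc S)
    {θ : ℕ → ℝ} (hθ : IsPartition θ)
    {v z : ℝ → E} (hv : Continuous v) (a b : ℝ) :
    IntervalIntegrable (fun s => outputRate f h (v s, holdInput kc θ z s)) volume a b := by
  obtain ⟨C, hC⟩ := ((isCompact_uIcc (a := a) (b := b)).image hv).prod H.isCompact
    |>.exists_bound_of_continuousOn H.rate_contDiff.continuous.continuousOn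
  rw [intervalIntegrable_iff]
  refine Measure.integrableOn_of_bounded (M := C) (by simp [uIoc]) ?_ ?_
  · exact (H.rate_contDiff.continuous.comp_stronglyMeasurable
      (hv.stronglyMeasurable.prodMk (stronglyMeasurable_holdInput hθ z))).aestronglyMeasurable
  · refine (ae_restrict_iff' measurableSet_uIoc).2 (ae_of_all _ fun s hs => ?_)
    exact hC _ ⟨mem_image_of_mem _ (uIoc_subset_uIcc hs), H.kc_mem _⟩

theorem continuous_rate_primitive (H : LoopRegular f h khat kc S)
    {θ : ℕ → ℝ} (hθ : IsPartition θ) {z : ℝ → E} (hz : Continuous z) (a : ℝ) :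
    Continuous fun t => ∫ s in a..t, outputRate f h (z s, holdInput kc θ z s) :=
  intervalIntegral.continuous_primitive (fun a b => H.rate_intervalIntegrable hθ hz a b) a

theorem stronglyMeasurable_loopField [FiniteDimensional ℝ E] [FiniteDimensional ℝ U]
    [FiniteDimensional ℝ Y] (H : LoopRegular f h khat kc S)
    {θ π : ℕ → ℝ} (hθ : IsPartition θ) (hπ : IsPartition π) {ξ : ℝ → E × E}
    (hξ : Continuous ξ) : StronglyMeasurable (loopField f h khat kc θ π ξ) := by
  have hu := stronglyMeasurable_holdInput (kc := kc) hθ fun s => (ξ s).2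
  have hw : StronglyMeasurable (predOutput f h π (holdInput kc θ fun s => (ξ s).2)
      (fun s => (ξ s).1) fun s => (ξ s).2) := by
    have h1 : StronglyMeasurable fun t => h ((ξ (π (cellIdx π t))).1) :=
      (StronglyMeasurable.of_discrete (f := fun j => h (ξ (π j)).1)).comp_measurable
        hπ.cellIdx_mono.measurable
    have hJ := H.continuous_rate_primitive hθ hξ.snd 0
    have h2 : StronglyMeasurable fun t => ∫ s in (0:ℝ)..π (cellIdx π t),
        outputRate f h ((ξ s).2, holdInput kc θ (fun s => (ξ s).2) s) :=
      (StronglyMeasurable.of_discrete (f := fun j => ∫ s in (0:ℝ)..π j,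
        outputRate f h ((ξ s).2, holdInput kc θ (fun s => (ξ s).2) s))).comp_measurable
        hπ.cellIdx_mono.measurable
    have h3 := h1.add (hJ.stronglyMeasurable.sub h2)
    convert h3 using 1
    ext1 t
    simp only [predOutput, Pi.add_apply, Pi.sub_apply]
    rw [intervalIntegral.integral_interval_sub_left (H.rate_intervalIntegrable hθ hξ.snd _ _)
      (H.rate_intervalIntegrable hθ hξ.snd _ _)]
  have hf := H.f_contDiff.continuous
  refine (hf.comp_stronglyMeasurable (hξ.fst.stronglyMeasurable.prodMk hu)).prodMk
    ((hf.comp_stronglyMeasurable (hξ.snd.stronglyMeasurable.prodMk hu)).add ?_)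
  borelize E
  borelize U
  borelize Y
  have hq : Measurable fun t => (⟨((ξ t).2, predOutput f h π (holdInput kc θ fun s => (ξ s).2)
      (fun s => (ξ s).1) (fun s => (ξ s).2) t, holdInput kc θ (fun s => (ξ s).2) t),
      mem_univ _, mem_univ _, H.kc_mem _⟩ : (univ ×ˢ univ ×ˢ S : Set (E × Y × U))) :=
    (hξ.snd.measurable.prodMk (hw.measurable.prodMk hu.measurable)).subtype_mk
  exact ((continuousOn_iff_continuous_domRestrict.1
    H.khat_lip.continuousOn).measurable.comp hq).stronglyMeasurable

theorem norm_prodMk_le_add {A B : Type*} [SeminormedAddCommGroup A] [SeminormedAddCommGroup B]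
    (a : A) (b : B) : ‖(a, b)‖ ≤ ‖a‖ + ‖b‖ :=
  max_le_add_of_nonneg (norm_nonneg a) (norm_nonneg b)

theorem exists_causalLipschitz [FiniteDimensional ℝ E] [FiniteDimensional ℝ Y]
    (H : LoopRegular f h khat kc S) (r : ℝ) :
    ∃ K, 0 < K ∧ ∀ θ π, IsPartition θ → IsPartition π → (∀ i, π (i + 1) - π i ≤ 1) →
      CausalLipschitz (loopField f h khat kc θ π) r K := by
  have hB : IsCompact (Metric.closedBall (0 : E) r) := isCompact_closedBall _ _
  have hBS := hB.prod H.isCompact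
  obtain ⟨Kf, hKf0, hKf⟩ :=
    (H.f_contDiff.locallyLipschitz.locallyLipschitzOn).exists_norm_sub_le hBS
  obtain ⟨Kd, hKd0, hKd⟩ :=
    (H.rate_contDiff.locallyLipschitz.locallyLipschitzOn).exists_norm_sub_le hBS
  obtain ⟨Cd, hCd⟩ := hBS.exists_bound_of_continuousOn H.rate_contDiff.continuous.continuousOn
  obtain ⟨Kh, hKh0, hKh⟩ := (H.h_contDiff.locallyLipschitz.locallyLipschitzOn).exists_norm_sub_le hB
  obtain ⟨Ch, hCh⟩ := hB.exists_bound_of_continuousOn H.h_contDiff.continuous.continuousOn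
  obtain ⟨Kk, hKk0, hKk⟩ := (H.kc_lip.locallyLipschitzOn).exists_norm_sub_le hB
  obtain ⟨Kg, hKg0, hKg⟩ := (H.khat_lip.mono
    (prod_mono (subset_univ _) (prod_mono (subset_univ (Metric.closedBall (0 : Y) (Ch + |Cd|)))
    subset_rfl))).exists_norm_sub_le (hB.prod ((isCompact_closedBall _ _).prod H.isCompact))
  let D := Kh + Kd * (1 + Kk)
  have hD : 0 ≤ D := by positivity
  refine ⟨2 * (Kf * (1 + Kk)) + Kg * (1 + (D + Kk)) + 1, by positivity, ?_⟩
  intro θ π hθ hπ hπ1 ξ ξ' hξ hξ' t ht d hd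
  have hd0 : 0 ≤ d := (norm_nonneg _).trans (hd 0 (left_mem_Icc.2 ht)).2.2
  have hfst : ∀ η : ℝ → E × E, ∀ s, ‖(η s).1‖ ≤ ‖η s‖ := fun η s => norm_fst_le _
  have hsnd : ∀ η : ℝ → E × E, ∀ s, ‖(η s).2‖ ≤ ‖η s‖ := fun η s => norm_snd_le _
  have hx : ∀ s ∈ Icc 0 t, (ξ s).1 ∈ Metric.closedBall (0 : E) r := fun s hs =>
    mem_closedBall_zero_iff.2 ((hfst ξ s).trans (hd s hs).1)
  have hx' : ∀ s ∈ Icc 0 t, (ξ' s).1 ∈ Metric.closedBall (0 : E) r := fun s hs =>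
    mem_closedBall_zero_iff.2 ((hfst ξ' s).trans (hd s hs).2.1)
  have hz : ∀ s ∈ Icc 0 t, (ξ s).2 ∈ Metric.closedBall (0 : E) r := fun s hs =>
    mem_closedBall_zero_iff.2 ((hsnd ξ s).trans (hd s hs).1)
  have hz' : ∀ s ∈ Icc 0 t, (ξ' s).2 ∈ Metric.closedBall (0 : E) r := fun s hs =>
    mem_closedBall_zero_iff.2 ((hsnd ξ' s).trans (hd s hs).2.1)
  have hdx : ∀ s ∈ Icc 0 t, ‖(ξ s).1 - (ξ' s).1‖ ≤ d := fun s hs =>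
    (norm_fst_le (ξ s - ξ' s)).trans (hd s hs).2.2
  have hdz : ∀ s ∈ Icc 0 t, ‖(ξ s).2 - (ξ' s).2‖ ≤ d := fun s hs =>
    (norm_snd_le (ξ s - ξ' s)).trans (hd s hs).2.2
  have hθt : ∀ s ∈ Icc 0 t, θ (cellIdx θ s) ∈ Icc 0 t := fun s hs =>
    ⟨hθ.nonneg _, (hθ.le_self hs.1).trans hs.2⟩
  set u := holdInput kc θ fun s => (ξ s).2 with hu_def
  set u' := holdInput kc θ fun s => (ξ' s).2 with hu'_def
  have hu : ∀ s, u s ∈ S := fun s => H.kc_mem _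
  have hu' : ∀ s, u' s ∈ S := fun s => H.kc_mem _
  have hdu : ∀ s ∈ Icc 0 t, ‖u s - u' s‖ ≤ Kk * d := fun s hs =>
    (hKk _ (hz _ (hθt s hs)) _ (hz' _ (hθt s hs))).trans
      (mul_le_mul_of_nonneg_left (hdz _ (hθt s hs)) hKk0)
  have hpt := hπ.le_self ht
  have hp0 := hπ.nonneg (cellIdx π t)
  have hp1 : t - π (cellIdx π t) ≤ 1 := by linarith [hπ1 (cellIdx π t), hπ.lt_succ t]
  have hcell : ∀ s ∈ uIoc (π (cellIdx π t)) t, s ∈ Icc 0 t := fun s hs => by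
    rw [uIoc_of_le hpt] at hs
    exact ⟨hp0.trans hs.1.le, hs.2⟩
  have habs : |t - π (cellIdx π t)| ≤ 1 := by rwa [abs_of_nonneg (sub_nonneg.2 hpt)]
  have hpm : π (cellIdx π t) ∈ Icc 0 t := ⟨hp0, hpt⟩
  have hwb : ∀ (η : ℝ → E × E), (∀ s ∈ Icc 0 t, (η s).1 ∈ Metric.closedBall (0 : E) r) →
      (∀ s ∈ Icc 0 t, (η s).2 ∈ Metric.closedBall (0 : E) r) →
      predOutput f h π (holdInput kc θ fun s => (η s).2) (fun s => (η s).1) (fun s => (η s).2) t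
        ∈ Metric.closedBall (0 : Y) (Ch + |Cd|) := fun η hη1 hη2 => by
    refine mem_closedBall_zero_iff.2 ((norm_add_le _ _).trans (add_le_add (hCh _ (hη1 _ hpm)) ?_))
    refine (intervalIntegral.norm_integral_le_of_norm_le_const (C := |Cd|) fun s hs =>
      (hCd _ ⟨hη2 s (hcell s hs), H.kc_mem _⟩).trans (le_abs_self _)).trans ?_
    exact mul_le_of_le_one_right (abs_nonneg _) habs
  have hdw : ‖predOutput f h π u (fun s => (ξ s).1) (fun s => (ξ s).2) t -
      predOutput f h π u' (fun s => (ξ' s).1) (fun s => (ξ' s).2) t‖ ≤ D * d := by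
    have h1 : ‖(∫ s in π (cellIdx π t)..t, outputRate f h ((ξ s).2, u s)) -
        ∫ s in π (cellIdx π t)..t, outputRate f h ((ξ' s).2, u' s)‖ ≤ Kd * ((1 + Kk) * d) := by
      rw [← intervalIntegral.integral_sub (H.rate_intervalIntegrable hθ hξ.snd _ _)
        (H.rate_intervalIntegrable hθ hξ'.snd _ _)]
      refine (intervalIntegral.norm_integral_le_of_norm_le_const (C := Kd * ((1 + Kk) * d))
        fun s hs => ?_).trans (mul_le_of_le_one_right (by positivity) habs)
      have hs' := hcell s hs
      refine (hKd _ ⟨hz s hs', hu s⟩ _ ⟨hz' s hs', hu' s⟩).trans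
        (mul_le_mul_of_nonneg_left ?_ hKd0)
      refine (norm_prodMk_le_add ((ξ s).2 - (ξ' s).2) (u s - u' s)).trans ?_
      linarith [hdz s hs', hdu s hs']
    have h2 := (hKh _ (hx _ hpm) _ (hx' _ hpm)).trans
      (mul_le_mul_of_nonneg_left (hdx _ hpm) hKh0)
    simp only [predOutput]
    rw [add_sub_add_comm]
    refine (norm_add_le _ _).trans ((add_le_add h2 h1).trans (le_of_eq ?_))
    simp only [D]
    ring
  have ht' : t ∈ Icc 0 t := right_mem_Icc.2 ht
  have hfx : ‖f (ξ t).1 (u t) - f (ξ' t).1 (u' t)‖ ≤ Kf * ((1 + Kk) * d) := by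
    refine (hKf ((ξ t).1, u t) ⟨hx t ht', hu t⟩ ((ξ' t).1, u' t)
      ⟨hx' t ht', hu' t⟩).trans (mul_le_mul_of_nonneg_left ?_ hKf0)
    refine (norm_prodMk_le_add ((ξ t).1 - (ξ' t).1) (u t - u' t)).trans ?_
    linarith [hdx t ht', hdu t ht']
  have hfz : ‖f (ξ t).2 (u t) - f (ξ' t).2 (u' t)‖ ≤ Kf * ((1 + Kk) * d) := by
    refine (hKf ((ξ t).2, u t) ⟨hz t ht', hu t⟩ ((ξ' t).2, u' t)
      ⟨hz' t ht', hu' t⟩).trans (mul_le_mul_of_nonneg_left ?_ hKf0)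
    refine (norm_prodMk_le_add ((ξ t).2 - (ξ' t).2) (u t - u' t)).trans ?_
    linarith [hdz t ht', hdu t ht']
  set w := predOutput f h π u (fun s => (ξ s).1) fun s => (ξ s).2 with hw_def
  set w' := predOutput f h π u' (fun s => (ξ' s).1) fun s => (ξ' s).2 with hw'_def
  have hgz : ‖khat (ξ t).2 (w t) (u t) - khat (ξ' t).2 (w' t) (u' t)‖ ≤
      Kg * ((1 + (D + Kk)) * d) := by
    refine (hKg ((ξ t).2, w t, u t) ⟨hz t ht', hwb ξ hx hz, hu t⟩ ((ξ' t).2, w' t, u' t)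
      ⟨hz' t ht', hwb ξ' hx' hz', hu' t⟩).trans (mul_le_mul_of_nonneg_left ?_ hKg0)
    have h1 := norm_prodMk_le_add ((ξ t).2 - (ξ' t).2) (w t - w' t, u t - u' t)
    have h2 := norm_prodMk_le_add (w t - w' t) (u t - u' t)
    refine h1.trans ?_
    linarith [hdz t ht', hdu t ht']
  have key : loopField f h khat kc θ π ξ t - loopField f h khat kc θ π ξ' t =
      (f (ξ t).1 (u t) - f (ξ' t).1 (u' t), (f (ξ t).2 (u t) - f (ξ' t).2 (u' t)) +
        (khat (ξ t).2 (w t) (u t) - khat (ξ' t).2 (w' t) (u' t))) := by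
    simp only [loopField, ← hu_def, ← hu'_def, ← hw_def, ← hw'_def, Prod.mk_sub_mk,
      add_sub_add_comm]
  rw [key]
  refine (norm_prodMk_le_add _ _).trans ((add_le_add hfx ((norm_add_le _ _).trans
    (add_le_add hfz hgz))).trans ?_)
  nlinarith

theorem rate_zero (H : LoopRegular f h khat kc S) : outputRate f h 0 = 0 := by
  simp [outputRate, H.f_zero]

theorem loopField_zero (H : LoopRegular f h khat kc S) (θ π : ℕ → ℝ) (t : ℝ) :
    loopField f h khat kc θ π 0 t = 0 := by
  have hr : outputRate f h ((0 : E), (0 : U)) = 0 := H.rate_zero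
  simp [loopField, predOutput, holdInput, H.kc_zero, H.f_zero, H.h_zero, H.khat_zero, hr]

end LoopRegular

end ClosedLoop

section ClosedLoopSolution

variable {E U Y : Type*} [NormedAddCommGroup E] [NormedSpace ℝ E]
  [NormedAddCommGroup U] [NormedSpace ℝ U] [NormedAddCommGroup Y] [NormedSpace ℝ Y]

namespace LoopRegular

variable {f : E → U → E} {h : E → Y} {khat : E → Y → U → E} {kc : E → U} {S : Set U}

theorem continuousWithinAt_loopField (H : LoopRegular f h khat kc S)
    {θ π : ℕ → ℝ} (hθ : IsPartition θ) (hπ : IsPartition π) {ξ : ℝ → E × E}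
    (hξ : Continuous ξ) {t : ℝ} (ht : 0 ≤ t) :
    ContinuousWithinAt (loopField f h khat kc θ π ξ) (Ici t) t := by
  let u₀ := kc (ξ (θ (cellIdx θ t))).2
  let τ := π (cellIdx π t)
  let w : ℝ → Y := fun s => h (ξ τ).1 +
    ∫ s in τ..s, outputRate f h ((ξ s).2, holdInput kc θ (fun s => (ξ s).2) s)
  have hw : Continuous w := continuous_const.add (H.continuous_rate_primitive hθ hξ.snd _)
  have hev : loopField f h khat kc θ π ξ =ᶠ[𝓝[≥] t] fun s =>
      (f (ξ s).1 u₀, f (ξ s).2 u₀ + khat (ξ s).2 (w s) u₀) := by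
    filter_upwards [hθ.eventually_cellIdx ht, hπ.eventually_cellIdx ht] with s h1 h2
    simp only [loopField, holdInput, predOutput, h1, h2, u₀, w, τ]
  refine ContinuousWithinAt.congr_of_eventuallyEq ?_ hev
    (hev.eq_of_nhdsWithin self_mem_Ici)
  have hf := H.f_contDiff.continuous
  have hk : ContinuousWithinAt (fun s => khat (ξ s).2 (w s) u₀) (Ici t) t :=
    (H.khat_lip.continuousOn.comp_continuous (f := fun s => ((ξ s).2, w s, u₀))
      (hξ.snd.prodMk (hw.prodMk continuous_const))
      fun s => ⟨mem_univ _, mem_univ _, H.kc_mem _⟩).continuousWithinAt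
  exact (hf.comp (hξ.fst.prodMk continuous_const)).continuousWithinAt.prodMk
    ((hf.comp (hξ.snd.prodMk continuous_const)).continuousWithinAt.add hk)

theorem loopField_intervalIntegrable [FiniteDimensional ℝ E] [FiniteDimensional ℝ U]
    [FiniteDimensional ℝ Y] (H : LoopRegular f h khat kc S)
    {θ π : ℕ → ℝ} (hθ : IsPartition θ) (hπ : IsPartition π) (hπ1 : ∀ i, π (i + 1) - π i ≤ 1)
    {ξ : ℝ → E × E} (hξ : Continuous ξ) {t : ℝ} (ht : 0 ≤ t) :
    IntervalIntegrable (loopField f h khat kc θ π ξ) volume 0 t := by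
  obtain ⟨r, hr⟩ := exists_bound_Icc hξ t
  obtain ⟨K, -, hK⟩ := H.exists_causalLipschitz r
  exact (hK θ π hθ hπ hπ1).intervalIntegrable (fun s _ => H.loopField_zero θ π s)
    (fun η hη => (H.stronglyMeasurable_loopField hθ hπ hη).aestronglyMeasurable) hξ ht hr

theorem hasDerivWithinAt_of_eq_integral [FiniteDimensional ℝ E] [FiniteDimensional ℝ U]
    [FiniteDimensional ℝ Y] (H : LoopRegular f h khat kc S)
    {θ π : ℕ → ℝ} (hθ : IsPartition θ) (hπ : IsPartition π) (hπ1 : ∀ i, π (i + 1) - π i ≤ 1)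
    {ξ : ℝ → E × E} (hξ : Continuous ξ) {ξ₀ : E × E} {T : ℝ}
    (hsol : ∀ t ∈ Icc 0 T, ξ t = ξ₀ + ∫ s in (0 : ℝ)..t, loopField f h khat kc θ π ξ s) :
    ∀ t ∈ Ico 0 T, HasDerivWithinAt ξ (loopField f h khat kc θ π ξ t) (Ici t) t := by
  intro t ht
  have h1 : HasDerivWithinAt (fun t => ξ₀ + ∫ s in (0 : ℝ)..t, loopField f h khat kc θ π ξ s)
      (loopField f h khat kc θ π ξ t) (Ici t) t :=
    (intervalIntegral.integral_hasDerivWithinAt_right (t := Ioi t)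
      (H.loopField_intervalIntegrable hθ hπ hπ1 hξ ht.1)
      ((H.stronglyMeasurable_loopField hθ hπ hξ).aestronglyMeasurable.stronglyMeasurableAtFilter)
      ((H.continuousWithinAt_loopField hθ hπ hξ ht.1).mono Ioi_subset_Ici_self)).const_add ξ₀
  refine h1.congr_of_eventuallyEq ?_ (hsol t ⟨ht.1, ht.2.le⟩)
  filter_upwards [Icc_mem_nhdsGE ht.2] with s hs
  exact hsol s ⟨ht.1.trans hs.1, hs.2⟩

theorem norm_predOutput_sub_le [CompleteSpace Y] (H : LoopRegular f h khat kc S)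
    {θ π : ℕ → ℝ} (hθ : IsPartition θ) (hπ : IsPartition π) {x z : ℝ → E} (hx : Continuous x)
    (hz : Continuous z) {t M : ℝ} (ht : 0 ≤ t)
    (hx' : ∀ s ∈ Ico 0 t, HasDerivWithinAt x (f (x s) (holdInput kc θ z s)) (Ici s) s)
    (hM : ∀ s ∈ Icc (π (cellIdx π t)) t, ‖outputRate f h (z s, holdInput kc θ z s) -
      outputRate f h (x s, holdInput kc θ z s)‖ ≤ M) :
    ‖predOutput f h π (holdInput kc θ z) x z t - h (x t)‖ ≤ M * (t - π (cellIdx π t)) := by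
  have hpt := hπ.le_self ht
  have hftc := intervalIntegral.integral_eq_sub_of_hasDeriv_right_of_le hpt
    (f := fun s => h (x s)) (f' := fun s => outputRate f h (x s, holdInput kc θ z s))
    (H.h_contDiff.continuous.comp hx).continuousOn (fun s hs => by
      have hs' : s ∈ Ico 0 t := ⟨(hπ.nonneg _).trans hs.1.le, hs.2⟩
      exact (H.h_contDiff.differentiable one_ne_zero (x s)).hasFDerivAt.comp_hasDerivWithinAt s
        ((hx' s hs').mono Ioi_subset_Ici_self)) (H.rate_intervalIntegrable hθ hx _ _)
  have heq : predOutput f h π (holdInput kc θ z) x z t - h (x t) =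
      ∫ s in π (cellIdx π t)..t, (outputRate f h (z s, holdInput kc θ z s) -
        outputRate f h (x s, holdInput kc θ z s)) := by
    rw [intervalIntegral.integral_sub (H.rate_intervalIntegrable hθ hz _ _)
      (H.rate_intervalIntegrable hθ hx _ _), hftc, predOutput]
    abel
  rw [heq]
  refine (intervalIntegral.norm_integral_le_of_norm_le_const (C := M) fun s hs =>
    hM s (Ioc_subset_Icc_self (uIoc_of_le hpt ▸ hs))).trans (le_of_eq ?_)
  rw [abs_of_nonneg (sub_nonneg.2 hpt)]

end LoopRegular

end ClosedLoopSolution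

section Design

variable {E U Y : Type*} [NormedAddCommGroup E] [InnerProductSpace ℝ E] [CompleteSpace E]
  [NormedAddCommGroup U] [NormedSpace ℝ U] [NormedAddCommGroup Y] [NormedSpace ℝ Y]

/-- The standing assumptions on the plant, the state feedback `kc` and the observer gain `khat`. -/
structure ObserverDesign (f : E → U → E) (S : Set U) (h : E → Y) (V W : E → ℝ) (R : ℝ)
    (P : E → ℝ) (μ K₁ : ℝ) (kc : E → U) (Q : E →L[ℝ] E) (ω b : ℝ) (L : Y →L[ℝ] E) (c a : ℝ)
    (p : ℝ → ℝ) (φ : E → Y → U → ℝ) (khat : E → Y → U → E) : Prop where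
  f_contDiff : ContDiff ℝ 2 (fun q : E × U => f q.1 q.2)
  f_zero : f 0 0 = 0
  isCompact : IsCompact S
  h_contDiff : ContDiff ℝ 2 h
  h_zero : h 0 = 0
  V_contDiff : ContDiff ℝ 2 V
  V_radial : ∀ M : ℝ, Bornology.IsBounded {x | V x ≤ M}
  W_contDiff : ContDiff ℝ 1 W
  W_pos : ∀ x ≠ 0, 0 < W x
  R_pos : 0 < R
  V_decay : ∀ x u, u ∈ S → R ≤ V x → ⟪gradient V x, f x u⟫ ≤ -W x
  V_nhds : {x | V x ≤ R} ∈ 𝓝 (0 : E)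
  gradient_ne_zero : ∀ z, R < V z → gradient V z ≠ 0
  P_contDiff : ContDiff ℝ 2 P
  P_zero : P 0 = 0
  P_pos : ∀ x ≠ 0, 0 < P x
  μ_pos : 0 < μ
  K₁_pos : 0 < K₁
  P_lower : ∀ x, V x ≤ R → K₁ * ‖x‖ ^ 2 ≤ P x
  kc_mem : ∀ x, kc x ∈ S
  kc_zero : kc 0 = 0
  kc_lip : LocallyLipschitz kc
  P_decay : ∀ x, V x ≤ R → ⟪gradient P x, f x (kc x)⟫ ≤ -2 * μ * ‖x‖ ^ 2
  Q_symm : ∀ v w : E, ⟪Q v, w⟫ = ⟪v, Q w⟫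
  Q_pos : ∀ v : E, v ≠ 0 → 0 < ⟪v, Q v⟫
  ω_pos : 0 < ω
  R_lt_b : R < b
  error_decay : ∀ u z x, u ∈ S → V z ≤ b → V x ≤ R →
    ⟪z - x, Q (f z u + L (h z - h x) - f x u)⟫ ≤ -ω * ‖z - x‖ ^ 2
  c_mem : c ∈ Ioo (0 : ℝ) 1
  R_le_a : R ≤ a
  V_observer_decay : ∀ u z x, u ∈ S → a < V z → V z ≤ b → ⟪gradient V z, Q (z - x)⟫ < 0 →
    V x ≤ R → ⟪gradient V z, f z u + L (h z - h x)⟫ ≤ -W z +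
      (1 - c) * ‖gradient V z‖ ^ 2 *
        ⟪z - x, Q (f z u + L (h z - h x) - f x u)⟫ / ⟪gradient V z, Q (z - x)⟫
  p_lip : LocallyLipschitz p
  p_mem : ∀ s, p s ∈ Icc (0 : ℝ) 1
  p_one : ∀ s, b ≤ s → p s = 1
  p_zero : ∀ s, s ≤ a → p s = 0
  φ_eq : ∀ z y u, φ z y u =
    max 0 (⟪gradient V z, f z u⟫ + W z + p (V z) * ⟪gradient V z, L (h z - y)⟫)
  khat_inner : ∀ z y u, V z ≤ R → khat z y u = L (h z - y)
  khat_outer : ∀ z y u, R < V z →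
    khat z y u = L (h z - y) - (φ z y u / ‖gradient V z‖ ^ 2) • gradient V z

namespace ObserverDesign

variable {f : E → U → E} {S : Set U} {h : E → Y} {V W : E → ℝ} {R : ℝ} {P : E → ℝ} {μ K₁ : ℝ}
  {kc : E → U} {Q : E →L[ℝ] E} {ω b : ℝ} {L : Y →L[ℝ] E} {c a : ℝ} {p : ℝ → ℝ}
  {φ : E → Y → U → ℝ} {khat : E → Y → U → E}

theorem loopRegular (D : ObserverDesign f S h V W R P μ K₁ kc Q ω b L c a p φ khat) :
    LoopRegular f h khat kc S where
  f_contDiff := D.f_contDiff.of_le one_le_two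
  rate_contDiff := ((D.h_contDiff.fderiv_right (m := 1) le_rfl).comp contDiff_fst).clm_apply
    (D.f_contDiff.of_le one_le_two)
  h_contDiff := D.h_contDiff.of_le one_le_two
  f_zero := D.f_zero
  h_zero := D.h_zero
  kc_lip := D.kc_lip
  kc_mem := D.kc_mem
  kc_zero := D.kc_zero
  isCompact := D.isCompact
  khat_lip := observerGain_locallyLipschitzOn (D.f_contDiff.of_le one_le_two)
    (D.h_contDiff.of_le one_le_two) D.V_contDiff D.W_contDiff D.W_pos D.V_decay D.V_nhds
    ⟨_, D.kc_mem 0⟩ L D.R_le_a D.p_lip D.p_zero D.φ_eq D.khat_inner D.khat_outer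
  khat_zero := by
    have h0 : V 0 ≤ R := by simpa using mem_of_mem_nhds D.V_nhds
    rw [D.khat_inner _ _ _ h0, D.h_zero, sub_zero, map_zero]

theorem drift_nonpos (D : ObserverDesign f S h V W R P μ K₁ kc Q ω b L c a p φ khat) {z : E}
    {u : U} (hu : u ∈ S) (hz : R < V z) : ⟪gradient V z, f z u⟫ + W z ≤ 0 := by
  linarith [D.V_decay z u hu hz.le]

theorem φ_le (D : ObserverDesign f S h V W R P μ K₁ kc Q ω b L c a p φ khat) {z : E} {y : Y}
    {u : U} (hu : u ∈ S) (hz : R < V z) : φ z y u ≤ ‖gradient V z‖ * ‖L (h z - y)‖ := by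
  rw [D.φ_eq]
  have h1 := real_inner_le_norm (gradient V z) (L (h z - y))
  have h2 := D.p_mem (V z)
  have h3 : p (V z) * ⟪gradient V z, L (h z - y)⟫ ≤ ‖gradient V z‖ * ‖L (h z - y)‖ :=
    (mul_le_mul_of_nonneg_left h1 h2.1).trans (mul_le_of_le_one_left (by positivity) h2.2)
  exact max_le (by positivity) (by linarith [D.drift_nonpos hu hz])

theorem norm_khat_le (D : ObserverDesign f S h V W R P μ K₁ kc Q ω b L c a p φ khat) (z : E)
    (y : Y) {u : U} (hu : u ∈ S) : ‖khat z y u‖ ≤ 2 * ‖L (h z - y)‖ := by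
  rcases le_or_gt (V z) R with hz | hz
  · rw [D.khat_inner _ _ _ hz]
    linarith [norm_nonneg (L (h z - y))]
  · rw [D.khat_outer _ _ _ hz]
    have hg : 0 < ‖gradient V z‖ := norm_pos_iff.2 (D.gradient_ne_zero z hz)
    have hφ0 : 0 ≤ φ z y u := D.φ_eq z y u ▸ le_max_left _ _
    refine (norm_sub_le _ _).trans ?_
    have : ‖(φ z y u / ‖gradient V z‖ ^ 2) • gradient V z‖ ≤ ‖L (h z - y)‖ := by
      rw [norm_smul, Real.norm_of_nonneg (by positivity), div_mul_eq_mul_div, div_le_iff₀ (by positivity)]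
      nlinarith [D.φ_le (y := y) hu hz]
    linarith

theorem inner_gradient_observer_le
    (D : ObserverDesign f S h V W R P μ K₁ kc Q ω b L c a p φ khat) {z : E} (y : Y) {u : U}
    (hz : b ≤ V z) : ⟪gradient V z, f z u + khat z y u⟫ ≤ -W z := by
  have hzR : R < V z := D.R_lt_b.trans_le hz
  have hg : 0 < ‖gradient V z‖ := norm_pos_iff.2 (D.gradient_ne_zero z hzR)
  have hφ : ⟪gradient V z, f z u⟫ + W z + ⟪gradient V z, L (h z - y)⟫ ≤ φ z y u := by
    rw [D.φ_eq, D.p_one _ hz, one_mul]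
    exact le_max_right _ _
  rw [D.khat_outer _ _ _ hzR, inner_add_right, inner_sub_right, real_inner_smul_right,
    real_inner_self_eq_norm_sq, div_mul_cancel₀ _ (by positivity)]
  linarith

theorem inner_error_le (D : ObserverDesign f S h V W R P μ K₁ kc Q ω b L c a p φ khat) {x z : E}
    (y : Y) {u : U} (hu : u ∈ S) (hz : V z ≤ b) (hx : V x ≤ R) :
    ⟪Q (z - x), f z u + khat z y u - f x u⟫ ≤
      -(c * ω) * ‖z - x‖ ^ 2 + 2 * ‖Q‖ * ‖L‖ * ‖z - x‖ * ‖y - h x‖ := by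
  set e := z - x
  set g := L (h z - h x) with hg_def
  set d := L (h x - y) with hd_def
  have hgd : L (h z - y) = g + d := by rw [hg_def, hd_def, ← map_add, sub_add_sub_cancel]
  have hE : ⟪Q e, f z u + g - f x u⟫ ≤ -ω * ‖e‖ ^ 2 := by
    rw [D.Q_symm]
    exact D.error_decay u z x hu hz hx
  have hQe : ‖Q e‖ ≤ ‖Q‖ * ‖e‖ := Q.le_opNorm e
  have hd : ‖d‖ ≤ ‖L‖ * ‖y - h x‖ := norm_sub_rev y (h x) ▸ L.le_opNorm _
  have hc := D.c_mem
  have hω := D.ω_pos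
  have hQd : ‖Q e‖ * ‖d‖ ≤ ‖Q‖ * ‖L‖ * ‖e‖ * ‖y - h x‖ :=
    (mul_le_mul hQe hd (norm_nonneg _) (by positivity)).trans (le_of_eq (by ring))
  have hin : ⟪Q e, d⟫ ≤ ‖Q e‖ * ‖d‖ := real_inner_le_norm _ _
  have hsq : 0 ≤ ω * ‖e‖ ^ 2 := by positivity
  set E₀ := ⟪Q e, f z u + g - f x u⟫ with hE₀
  suffices hk : ⟪Q e, khat z y u⟫ ≤ ⟪Q e, g⟫ + ⟪Q e, d⟫ + (-((1 - c) * E₀) + ‖Q e‖ * ‖d‖) by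
    have h1 : ⟪Q e, f z u + khat z y u - f x u⟫ =
        E₀ - ⟪Q e, g⟫ + ⟪Q e, khat z y u⟫ := by
      rw [hE₀]
      simp only [inner_add_right, inner_sub_right]
      ring
    rw [h1]
    nlinarith [hc.1]
  have hE₀n : 0 ≤ -((1 - c) * E₀) := by nlinarith [hc.2]
  have hdn : 0 ≤ ‖Q e‖ * ‖d‖ := by positivity
  rcases le_or_gt (V z) R with hzR | hzR
  · rw [D.khat_inner _ _ _ hzR, hgd, inner_add_right]
    linarith
  have hg : 0 < ‖gradient V z‖ := norm_pos_iff.2 (D.gradient_ne_zero z hzR)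
  have hφ0 : 0 ≤ φ z y u := D.φ_eq z y u ▸ le_max_left _ _
  have hA := D.drift_nonpos hu hzR
  rw [D.khat_outer _ _ _ hzR, hgd, inner_sub_right, inner_add_right, real_inner_smul_right,
    real_inner_comm (gradient V z)]
  set s := ⟪gradient V z, Q e⟫ with hs_def
  suffices hρ : φ z y u / ‖gradient V z‖ ^ 2 * (-s) ≤ -((1 - c) * E₀) + ‖Q e‖ * ‖d‖ by linarith
  rcases le_or_gt 0 s with hs | hs
  · have : 0 ≤ φ z y u / ‖gradient V z‖ ^ 2 * s := by positivity
    linarith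
  rcases le_or_gt (V z) a with hza | hza
  · have : φ z y u = 0 := by
      rw [D.φ_eq, D.p_zero _ hza, zero_mul, add_zero, max_eq_left hA]
    rw [this, zero_div, zero_mul]
    linarith
  have hB := D.V_observer_decay u z x hu hza hz hs hx
  rw [← D.Q_symm, inner_add_right] at hB
  have hp := D.p_mem (V z)
  set X := (1 - c) * ‖gradient V z‖ ^ 2 * E₀ / s with hX
  have hX0 : 0 ≤ X := by
    rw [hX]
    refine div_nonneg_of_nonpos ?_ hs.le
    nlinarith [sq_nonneg ‖gradient V z‖]
  have hφX : φ z y u ≤ X + ‖gradient V z‖ * ‖d‖ := by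
    have h1 := real_inner_le_norm (gradient V z) d
    have h2 : 0 ≤ ‖gradient V z‖ * ‖d‖ := by positivity
    rw [D.φ_eq, hgd, inner_add_right]
    refine max_le (by positivity) ?_
    nlinarith [hp.1, hp.2, mul_le_mul_of_nonneg_left h1 hp.1, mul_le_of_le_one_left h2 hp.2,
      mul_le_mul_of_nonneg_left hB hp.1, mul_le_of_le_one_left hX0 hp.2,
      mul_nonneg (sub_nonneg.2 hp.2) (neg_nonneg.2 hA)]
  have hsb : -s ≤ ‖gradient V z‖ * ‖Q e‖ := (neg_le_abs _).trans (abs_real_inner_le_norm _ _)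
  rw [div_mul_eq_mul_div, div_le_iff₀ (by positivity)]
  have h1 : X * (-s) = -((1 - c) * E₀) * ‖gradient V z‖ ^ 2 := by
    rw [hX]
    field_simp [hs.ne]
  have h2 : ‖gradient V z‖ * ‖d‖ * (-s) ≤ ‖Q e‖ * ‖d‖ * ‖gradient V z‖ ^ 2 :=
    (mul_le_mul_of_nonneg_left hsb (by positivity)).trans (le_of_eq (by ring))
  have h3 := mul_le_mul_of_nonneg_right hφX (neg_nonneg.2 hs.le)
  linarith

end ObserverDesign

end Design

section Dissipation

variable {E U Y : Type*} [NormedAddCommGroup E] [InnerProductSpace ℝ E]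

theorem mul_add_le_sq_add_sq {μ : ℝ} (hμ : 0 < μ) (m X A B : ℝ) :
    m * X * (A + B) ≤ μ * X ^ 2 + m ^ 2 / (2 * μ) * (A ^ 2 + B ^ 2) := by
  have h2 : 0 ≤ (2 * μ * X - m * (A + B)) ^ 2 := sq_nonneg _
  have h3 : 0 ≤ m ^ 2 * (A - B) ^ 2 := by positivity
  refine le_of_mul_le_mul_left (a := 4 * μ) ?_ (by positivity)
  have h4 : 4 * μ * (μ * X ^ 2 + m ^ 2 / (2 * μ) * (A ^ 2 + B ^ 2)) =
      4 * μ ^ 2 * X ^ 2 + 2 * m ^ 2 * (A ^ 2 + B ^ 2) := by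
    field_simp
    ring
  rw [h4]
  linarith

theorem two_mul_le_sq_add_sq {ν : ℝ} (hν : 0 < ν) (m X A : ℝ) :
    2 * (m * X * A) ≤ ν * X ^ 2 + m ^ 2 / ν * A ^ 2 := by
  have h2 : 0 ≤ (ν * X - m * A) ^ 2 := sq_nonneg _
  refine le_of_mul_le_mul_left (a := ν) ?_ hν
  have h4 : ν * (ν * X ^ 2 + m ^ 2 / ν * A ^ 2) = ν ^ 2 * X ^ 2 + m ^ 2 * A ^ 2 := by
    field_simp
  rw [h4]
  linarith

theorem inner_clm_self_le (Q : E →L[ℝ] E) (v : E) : ⟪v, Q v⟫ ≤ ‖Q‖ * ‖v‖ ^ 2 := by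
  refine (real_inner_le_norm _ _).trans ?_
  linarith [mul_le_mul_of_nonneg_left (Q.le_opNorm v) (norm_nonneg v)]

theorem inner_gradient_eq_fderiv [CompleteSpace E] (V : E → ℝ) (x v : E) :
    ⟪gradient V x, v⟫ = fderiv ℝ V x v :=
  InnerProductSpace.toDual_symm_apply

theorem HasDerivWithinAt.comp_gradient [CompleteSpace E] {V : E → ℝ} (hV : ContDiff ℝ 2 V)
    {x : ℝ → E} {x' : E} {s : Set ℝ} {t : ℝ} (hx : HasDerivWithinAt x x' s t) :
    HasDerivWithinAt (fun t => V (x t)) ⟪gradient V (x t), x'⟫ s t := by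
  rw [inner_gradient_eq_fderiv]
  exact (hV.differentiable two_ne_zero (x t)).hasFDerivAt.comp_hasDerivWithinAt t hx

theorem exists_coercive_of_pos [FiniteDimensional ℝ E] (Q : E →L[ℝ] E)
    (hQ : ∀ v : E, v ≠ 0 → 0 < ⟪v, Q v⟫) : ∃ q, 0 < q ∧ ∀ v : E, q * ‖v‖ ^ 2 ≤ ⟪v, Q v⟫ := by
  obtain ⟨q, hq, hqv⟩ := (isCompact_sphere (0 : E) 1).exists_forall_le'
    (f := fun v => ⟪v, Q v⟫) (a := 0) (by fun_prop) fun v hv =>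
      hQ v (ne_zero_of_mem_unit_sphere ⟨v, hv⟩)
  refine ⟨q, hq, fun v => ?_⟩
  rcases eq_or_ne v 0 with rfl | hv
  · simp
  have hv' : 0 < ‖v‖ := norm_pos_iff.2 hv
  have := hqv (‖v‖⁻¹ • v) (by simp [norm_smul, hv'.ne'])
  rw [map_smul, real_inner_smul_left, real_inner_smul_right] at this
  field_simp at this
  linarith

theorem exists_norm_gradient_le [FiniteDimensional ℝ E] {P : E → ℝ} (hP : ContDiff ℝ 2 P)
    (hmin : ∀ x, P 0 ≤ P x) (r : ℝ) :
    ∃ K, 0 ≤ K ∧ ∀ x : E, ‖x‖ ≤ r → ‖gradient P x‖ ≤ K * ‖x‖ := by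
  obtain ⟨K, hK0, hK⟩ := ((contDiff_gradient hP).locallyLipschitz.locallyLipschitzOn
    ).exists_norm_sub_le (isCompact_closedBall (0 : E) r)
  have h0 : gradient P 0 = 0 := by
    have : IsLocalMin P 0 := Eventually.of_forall hmin
    simp [gradient, this.fderiv_eq_zero]
  refine ⟨K, hK0, fun x hx => ?_⟩
  have hr : 0 ≤ r := (norm_nonneg x).trans hx
  simpa [h0] using hK x (mem_closedBall_zero_iff.2 hx) 0 (Metric.mem_closedBall_self hr)

theorem le_add_mul_sq_of_norm_gradient_le [CompleteSpace E] {P : E → ℝ} (hP : ContDiff ℝ 2 P)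
    {K r : ℝ} (hK0 : 0 ≤ K) (hK : ∀ x : E, ‖x‖ ≤ r → ‖gradient P x‖ ≤ K * ‖x‖) {x : E}
    (hx : ‖x‖ ≤ r) : P x ≤ P 0 + K * ‖x‖ ^ 2 := by
  have h := (convex_closedBall (0 : E) ‖x‖).norm_image_sub_le_of_norm_fderiv_le (𝕜 := ℝ)
    (f := P) (C := K * ‖x‖) (fun v _ => hP.differentiable two_ne_zero v) (fun v hv => by
      have hv' := mem_closedBall_zero_iff.1 hv
      have h1 : ‖fderiv ℝ P v‖ = ‖gradient P v‖ := by simp [gradient]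
      rw [h1]
      exact (hK v (hv'.trans hx)).trans (mul_le_mul_of_nonneg_left hv' hK0))
    (Metric.mem_closedBall_self (norm_nonneg x)) (mem_closedBall_zero_iff.2 le_rfl)
  have := (Real.le_norm_self _).trans h
  rw [sub_zero] at this
  linarith

/-- The quadratic-type Lyapunov function `P(x) + ρ (z - x)ᵀ Q (z - x)`. -/
noncomputable def errorLyapunov (P : E → ℝ) (Q : E →L[ℝ] E) (ρ : ℝ) (ξ : E × E) : ℝ :=
  P ξ.1 + ρ * ⟪ξ.2 - ξ.1, Q (ξ.2 - ξ.1)⟫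

theorem errorLyapunov_ge {P : E → ℝ} {Q : E →L[ℝ] E} {K₁ q₀ ρ : ℝ} (hρ : 0 ≤ ρ)
    (hq₀ : 0 ≤ q₀) (hK₁ : 0 ≤ K₁)
    (hQ : ∀ v : E, q₀ * ‖v‖ ^ 2 ≤ ⟪v, Q v⟫) {ξ : E × E} (hP : K₁ * ‖ξ.1‖ ^ 2 ≤ P ξ.1) :
    min K₁ (ρ * q₀) / 2 * ‖ξ‖ ^ 2 ≤ errorLyapunov P Q ρ ξ := by
  obtain ⟨x, z⟩ := ξ
  dsimp only at hP
  set e := z - x with he_def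
  have hY : errorLyapunov P Q ρ (x, z) = P x + ρ * ⟪e, Q e⟫ := rfl
  have hQ1' := mul_le_mul_of_nonneg_left (hQ e) hρ
  set q := min K₁ (ρ * q₀)
  have hq : 0 ≤ q := le_min hK₁ (mul_nonneg hρ hq₀)
  have h1 := mul_le_mul_of_nonneg_right (min_le_left K₁ (ρ * q₀)) (sq_nonneg ‖x‖)
  have h2 := mul_le_mul_of_nonneg_right (min_le_right K₁ (ρ * q₀)) (sq_nonneg ‖e‖)
  have hze : ‖z‖ ≤ ‖x‖ + ‖e‖ := by
    simpa [he_def] using norm_add_le x e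
  have h3 : ‖z‖ ^ 2 ≤ 2 * ‖x‖ ^ 2 + 2 * ‖e‖ ^ 2 := by
    nlinarith [norm_nonneg z, sq_nonneg (‖x‖ - ‖e‖)]
  have h4 : ‖(x, z)‖ ^ 2 ≤ 2 * ‖x‖ ^ 2 + 2 * ‖e‖ ^ 2 := by
    rcases max_choice ‖x‖ ‖z‖ with hmx | hmx
    · rw [Prod.norm_mk, hmx]
      nlinarith [sq_nonneg ‖x‖, sq_nonneg ‖e‖]
    · rwa [Prod.norm_mk, hmx]
  have h5 := mul_le_mul_of_nonneg_left h4 hq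
  rw [hY]
  linarith

theorem errorLyapunov_le {P : E → ℝ} (Q : E →L[ℝ] E) {K ρ : ℝ} (hρ : 0 ≤ ρ) (hK : 0 ≤ K)
    {ξ : E × E} (hP : P ξ.1 ≤ K * ‖ξ.1‖ ^ 2) :
    errorLyapunov P Q ρ ξ ≤ (K + 4 * (ρ * ‖Q‖) + 1) * ‖ξ‖ ^ 2 := by
  obtain ⟨x, z⟩ := ξ
  dsimp only at hP
  set e := z - x with he_def
  have hxn : ‖x‖ ≤ ‖(x, z)‖ := norm_fst_le (x, z)
  have hzn : ‖z‖ ≤ ‖(x, z)‖ := norm_snd_le (x, z)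
  have hQ2 := mul_le_mul_of_nonneg_left (inner_clm_self_le Q e) hρ
  have hY : errorLyapunov P Q ρ (x, z) = P x + ρ * ⟪e, Q e⟫ := rfl
  have hen : ‖e‖ ≤ 2 * ‖(x, z)‖ := (norm_sub_le z x).trans (by linarith)
  have h1 : ‖e‖ ^ 2 ≤ (2 * ‖(x, z)‖) ^ 2 := pow_le_pow_left₀ (norm_nonneg e) hen 2
  have h2 : ‖x‖ ^ 2 ≤ ‖(x, z)‖ ^ 2 := pow_le_pow_left₀ (norm_nonneg x) hxn 2
  have h3 := mul_le_mul_of_nonneg_left h1 (by positivity : 0 ≤ ρ * ‖Q‖)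
  have h4 := mul_le_mul_of_nonneg_left h2 hK
  rw [hY]
  linarith [sq_nonneg ‖(x, z)‖]

theorem mul_errorLyapunov_le {P : E → ℝ} {Q : E →L[ℝ] E} {μ K ρ : ℝ} (hμ : 0 < μ) (hρ : 0 ≤ ρ)
    (hK : 0 ≤ K) {ξ : E × E} (hP0 : 0 ≤ P ξ.1) (hP : P ξ.1 ≤ K * ‖ξ.1‖ ^ 2)
    (hQ0 : 0 ≤ ⟪ξ.2 - ξ.1, Q (ξ.2 - ξ.1)⟫) :
    min (μ / (K + 1)) (1 / (ρ * ‖Q‖ + 1)) * errorLyapunov P Q ρ ξ ≤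
      μ * ‖ξ.1‖ ^ 2 + ‖ξ.2 - ξ.1‖ ^ 2 := by
  have hQ2 := mul_le_mul_of_nonneg_left (inner_clm_self_le Q (ξ.2 - ξ.1)) hρ
  have h1 : min (μ / (K + 1)) (1 / (ρ * ‖Q‖ + 1)) * P ξ.1 ≤ μ * ‖ξ.1‖ ^ 2 := by
    refine (mul_le_mul_of_nonneg_right (min_le_left _ _) hP0).trans ?_
    rw [div_mul_eq_mul_div, div_le_iff₀ (by positivity)]
    have := mul_le_mul_of_nonneg_left hP hμ.le
    have : 0 ≤ μ * ‖ξ.1‖ ^ 2 := by positivity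
    linarith
  have h2 : min (μ / (K + 1)) (1 / (ρ * ‖Q‖ + 1)) * (ρ * ⟪ξ.2 - ξ.1, Q (ξ.2 - ξ.1)⟫) ≤
      ‖ξ.2 - ξ.1‖ ^ 2 := by
    refine (mul_le_mul_of_nonneg_right (min_le_right _ _) (mul_nonneg hρ hQ0)).trans ?_
    rw [div_mul_eq_mul_div, div_le_iff₀ (by positivity), one_mul]
    linarith [sq_nonneg ‖ξ.2 - ξ.1‖]
  rw [errorLyapunov, mul_add]
  linarith

variable [NormedAddCommGroup U] [NormedSpace ℝ U] [NormedAddCommGroup Y] [NormedSpace ℝ Y]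

namespace ObserverDesign

variable [FiniteDimensional ℝ E]
  {f : E → U → E} {S : Set U} {h : E → Y} {V W : E → ℝ} {R : ℝ} {P : E → ℝ} {μ K₁ : ℝ}
  {kc : E → U} {Q : E →L[ℝ] E} {ω b : ℝ} {L : Y →L[ℝ] E} {c a : ℝ} {p : ℝ → ℝ}
  {φ : E → Y → U → ℝ} {khat : E → Y → U → E}

theorem exists_dissipation
    (D : ObserverDesign f S h V W R P μ K₁ kc Q ω b L c a p φ khat) {r : ℝ}
    (hr : ∀ x, V x ≤ b → ‖x‖ ≤ r) :
    ∃ ρ α κ q q', 0 < α ∧ 0 < κ ∧ 0 < q ∧ 0 < q' ∧ ∀ ξ : E × E, V ξ.1 ≤ R → V ξ.2 ≤ b →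
      q * ‖ξ‖ ^ 2 ≤ errorLyapunov P Q ρ ξ ∧ errorLyapunov P Q ρ ξ ≤ q' * ‖ξ‖ ^ 2 ∧
      ∀ (y : Y) (ζ : E), ‖ζ‖ ≤ r →
        ⟪gradient P ξ.1, f ξ.1 (kc ζ)⟫ + 2 * ρ *
          ⟪Q (ξ.2 - ξ.1), f ξ.2 (kc ζ) + khat ξ.2 y (kc ζ) - f ξ.1 (kc ζ)⟫ ≤
        -α * errorLyapunov P Q ρ ξ + κ * (‖y - h ξ.1‖ ^ 2 + ‖ζ - ξ.2‖ ^ 2) := by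
  have hPmin : ∀ x, P 0 ≤ P x := fun x => by
    rcases eq_or_ne x 0 with rfl | hx
    · rfl
    · exact D.P_zero ▸ (D.P_pos x hx).le
  have hB : IsCompact (Metric.closedBall (0 : E) r) := isCompact_closedBall _ _
  obtain ⟨KP, hKP0, hKP⟩ := exists_norm_gradient_le D.P_contDiff hPmin r
  obtain ⟨q₀, hq₀, hQlow⟩ := exists_coercive_of_pos Q D.Q_pos
  obtain ⟨Kf, hKf0, hKf⟩ := (D.loopRegular.f_contDiff.locallyLipschitz.locallyLipschitzOn
    ).exists_norm_sub_le (hB.prod D.isCompact)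
  obtain ⟨Kk, hKk0, hKk⟩ := (D.kc_lip.locallyLipschitzOn).exists_norm_sub_le hB
  have hμ := D.μ_pos
  have hK₁ := D.K₁_pos
  have hcω : 0 < c * ω := mul_pos D.c_mem.1 D.ω_pos
  set m := KP * (Kf * Kk)
  have hm : 0 ≤ m := by positivity
  set κ₁ := m ^ 2 / (2 * μ)
  have hκ₁ : 0 ≤ κ₁ := by positivity
  set ρ := (κ₁ + 1) / (c * ω) with hρ_def
  have hρ : 0 < ρ := by positivity
  have hρc : ρ * (c * ω) = κ₁ + 1 := div_mul_cancel₀ _ hcω.ne'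
  set κ₂ := 2 * ‖Q‖ * ‖L‖
  have hκ₂ : 0 ≤ κ₂ := by positivity
  refine ⟨ρ, min (μ / (KP + 1)) (1 / (ρ * ‖Q‖ + 1)), κ₁ + ρ * κ₂ ^ 2 / (c * ω) + 1,
    min K₁ (ρ * q₀) / 2, KP + 4 * (ρ * ‖Q‖) + 1, by positivity, by positivity, by positivity,
    by positivity, ?_⟩
  rintro ⟨x, z⟩ hx hz
  dsimp only at hx hz
  have hxr : ‖x‖ ≤ r := hr x (hx.trans D.R_lt_b.le)
  have hzr : ‖z‖ ≤ r := hr z hz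
  have hP0 : 0 ≤ P x := D.P_zero ▸ hPmin x
  have hP2 : P x ≤ KP * ‖x‖ ^ 2 := by
    simpa [D.P_zero] using le_add_mul_sq_of_norm_gradient_le D.P_contDiff hKP0 hKP hxr
  refine ⟨errorLyapunov_ge hρ.le hq₀.le hK₁.le hQlow (D.P_lower x hx),
    errorLyapunov_le Q hρ.le hKP0 hP2, fun y ζ hζ => ?_⟩
  dsimp only
  have hαY := mul_errorLyapunov_le (ξ := (x, z)) hμ hρ.le hKP0 hP0 hP2
    ((mul_nonneg hq₀.le (sq_nonneg _)).trans (hQlow _))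
  dsimp only at hαY
  set e := z - x with he_def
  have hu := D.kc_mem ζ
  have he := D.inner_error_le y hu hz hx
  rw [← he_def] at he
  have hζx : ‖ζ - x‖ ≤ ‖ζ - z‖ + ‖e‖ := by
    simpa [he_def] using norm_add_le (ζ - z) e
  have hfd : ‖f x (kc ζ) - f x (kc x)‖ ≤ Kf * Kk * (‖ζ - z‖ + ‖e‖) := by
    have h1 := hKf (x, kc ζ) ⟨mem_closedBall_zero_iff.2 hxr, hu⟩ (x, kc x)
      ⟨mem_closedBall_zero_iff.2 hxr, D.kc_mem x⟩
    have h2 := hKk ζ (mem_closedBall_zero_iff.2 hζ) x (mem_closedBall_zero_iff.2 hxr)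
    rw [Prod.mk_sub_mk, sub_self, Prod.norm_mk, norm_zero, max_eq_right (norm_nonneg _)] at h1
    calc _ ≤ Kf * (Kk * ‖ζ - x‖) := h1.trans (mul_le_mul_of_nonneg_left h2 hKf0)
      _ ≤ Kf * (Kk * (‖ζ - z‖ + ‖e‖)) := by gcongr
      _ = _ := by ring
  have hPd : ⟪gradient P x, f x (kc ζ)⟫ ≤
      -2 * μ * ‖x‖ ^ 2 + m * ‖x‖ * (‖ζ - z‖ + ‖e‖) := by
    have h1 : ⟪gradient P x, f x (kc ζ)⟫ = ⟪gradient P x, f x (kc x)⟫ +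
        ⟪gradient P x, f x (kc ζ) - f x (kc x)⟫ := by rw [inner_sub_right]; ring
    have h2 := (real_inner_le_norm (gradient P x) (f x (kc ζ) - f x (kc x))).trans
      (mul_le_mul (hKP x hxr) hfd (norm_nonneg _) (by positivity))
    have h3 : KP * ‖x‖ * (Kf * Kk * (‖ζ - z‖ + ‖e‖)) = m * ‖x‖ * (‖ζ - z‖ + ‖e‖) := by
      simp only [m]; ring
    linarith [D.P_decay x hx]
  have hyoung := mul_add_le_sq_add_sq hμ m ‖x‖ ‖ζ - z‖ ‖e‖
  have hyoung2 := two_mul_le_sq_add_sq hcω κ₂ ‖e‖ ‖y - h x‖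
  have he2 := mul_le_mul_of_nonneg_left he (by positivity : 0 ≤ 2 * ρ)
  have hy2 := mul_le_mul_of_nonneg_left hyoung2 hρ.le
  have hρe : ρ * (c * ω) * ‖e‖ ^ 2 = (κ₁ + 1) * ‖e‖ ^ 2 := by rw [hρc]
  have hk : ρ * (κ₂ ^ 2 / (c * ω) * ‖y - h x‖ ^ 2) =
      ρ * κ₂ ^ 2 / (c * ω) * ‖y - h x‖ ^ 2 := by ring
  have hpos1 : 0 ≤ ρ * κ₂ ^ 2 / (c * ω) * ‖ζ - z‖ ^ 2 := by positivity
  have hpos2 : 0 ≤ κ₁ * ‖y - h x‖ ^ 2 := by positivity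
  have hpos3 := sq_nonneg ‖y - h x‖
  have hpos4 := sq_nonneg ‖ζ - z‖
  linarith

end ObserverDesign

end Dissipation

section Trajectories

variable {E U Y : Type*} [NormedAddCommGroup E] [InnerProductSpace ℝ E] [FiniteDimensional ℝ E]

theorem HasDerivWithinAt.fst_snd {A B : Type*} [NormedAddCommGroup A] [NormedSpace ℝ A]
    [NormedAddCommGroup B] [NormedSpace ℝ B] {ξ : ℝ → A × B} {ξ' : A × B} {s : Set ℝ} {t : ℝ}
    (hξ : HasDerivWithinAt ξ ξ' s t) : HasDerivWithinAt (fun t => (ξ t).1) ξ'.1 s t ∧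
      HasDerivWithinAt (fun t => (ξ t).2) ξ'.2 s t :=
  ⟨(ContinuousLinearMap.fst ℝ A B).hasFDerivAt.comp_hasDerivWithinAt t hξ,
    (ContinuousLinearMap.snd ℝ A B).hasFDerivAt.comp_hasDerivWithinAt t hξ⟩

theorem le_max_of_inner_gradient_le {V W : E → ℝ} (hV : ContDiff ℝ 2 V) {y y' : ℝ → E}
    {T r M δ : ℝ} (hδ : 0 ≤ δ) (hrM : r ≤ M)
    (hW0 : ∀ x, r < V x → 0 ≤ W x) (hW : ∀ x, r < V x → V x ≤ M → δ ≤ W x)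
    (hy : Continuous y) (hy' : ∀ t ∈ Ico 0 T, HasDerivWithinAt y (y' t) (Ici t) t)
    (hdecay : ∀ t ∈ Ico 0 T, r < V (y t) → ⟪gradient V (y t), y' t⟫ ≤ -W (y t))
    (h0 : V (y 0) ≤ M) : ∀ t ∈ Icc 0 T, V (y t) ≤ max r (M - δ * t) := by
  have hc : ContinuousOn (fun t => V (y t)) (Icc 0 T) := (hV.continuous.comp hy).continuousOn
  have hd := fun t (ht : t ∈ Ico 0 T) => HasDerivWithinAt.comp_gradient hV (hy' t ht)
  have hM : ∀ t ∈ Icc 0 T, V (y t) ≤ M := fun t ht => by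
    refine (le_max_of_right_deriv_le_neg le_rfl hc hd (fun t ht h1 => ?_) t ht).trans
      (max_le hrM (by simpa using h0))
    rw [neg_zero]
    exact (hdecay t ht h1).trans (neg_nonpos.2 (hW0 _ h1))
  intro t ht
  refine (le_max_of_right_deriv_le_neg hδ hc hd (fun t ht h1 => ?_) t ht).trans
    (max_le_max le_rfl (by linarith))
  exact (hdecay t ht h1).trans (neg_le_neg (hW _ h1 (hM t ⟨ht.1, ht.2.le⟩)))

variable [NormedAddCommGroup U] [NormedSpace ℝ U] [NormedAddCommGroup Y] [NormedSpace ℝ Y]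

namespace ObserverDesign

variable {f : E → U → E} {S : Set U} {h : E → Y} {V W : E → ℝ} {R : ℝ} {P : E → ℝ} {μ K₁ : ℝ}
  {kc : E → U} {Q : E →L[ℝ] E} {ω b : ℝ} {L : Y →L[ℝ] E} {c a : ℝ} {p : ℝ → ℝ}
  {φ : E → Y → U → ℝ} {khat : E → Y → U → E}

theorem isCompact_sublevel (D : ObserverDesign f S h V W R P μ K₁ kc Q ω b L c a p φ khat)
    (M : ℝ) : IsCompact {x | V x ≤ M} :=
  Metric.isCompact_of_isClosed_isBounded (isClosed_le D.V_contDiff.continuous continuous_const)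
    (D.V_radial M)

theorem ne_zero_of_lt (D : ObserverDesign f S h V W R P μ K₁ kc Q ω b L c a p φ khat) {x : E}
    (hx : R < V x) : x ≠ 0 := by
  rintro rfl
  have h0 : V 0 ≤ R := by simpa using mem_of_mem_nhds D.V_nhds
  linarith

theorem exists_le_W (D : ObserverDesign f S h V W R P μ K₁ kc Q ω b L c a p φ khat) (M : ℝ) :
    ∃ δ, 0 < δ ∧ ∀ x, R < V x → V x ≤ M → δ ≤ W x := by
  obtain ⟨δ, hδ, hW⟩ := ((D.isCompact_sublevel M).diff (t := interior {x | V x ≤ R})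
    isOpen_interior).exists_forall_le' D.W_contDiff.continuous.continuousOn (a := 0)
      fun x hx => D.W_pos x (by
        rintro rfl
        exact hx.2 (mem_interior_iff_mem_nhds.2 D.V_nhds))
  refine ⟨δ, hδ, fun x hx hxM => hW x ⟨hxM, fun hx' => ?_⟩⟩
  have : V x ≤ R := by simpa using interior_subset hx'
  linarith

theorem V_le_of_trajectory (D : ObserverDesign f S h V W R P μ K₁ kc Q ω b L c a p φ khat)
    {θ π : ℕ → ℝ} {ξ : ℝ → E × E} (hξ : Continuous ξ) {T M δ : ℝ}
    (hξ' : ∀ t ∈ Ico 0 T, HasDerivWithinAt ξ (loopField f h khat kc θ π ξ t) (Ici t) t)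
    (hδ : 0 ≤ δ) (hW : ∀ x, R < V x → V x ≤ M → δ ≤ W x) (hbM : b ≤ M)
    (hx0 : V (ξ 0).1 ≤ M) (hz0 : V (ξ 0).2 ≤ M) : ∀ t ∈ Icc 0 T,
      V (ξ t).1 ≤ max R (M - δ * t) ∧ V (ξ t).2 ≤ max b (M - δ * t) := by
  have hRb := D.R_lt_b
  have hW0 : ∀ x, R < V x → 0 ≤ W x := fun x hx => (D.W_pos x (D.ne_zero_of_lt hx)).le
  refine fun t ht => ⟨?_, ?_⟩
  · exact le_max_of_inner_gradient_le D.V_contDiff hδ (hRb.le.trans hbM) hW0 hW hξ.fst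
      (fun t ht => (hξ' t ht).fst_snd.1)
      (fun t _ h1 => D.V_decay _ _ (D.kc_mem _) h1.le) hx0 t ht
  · exact le_max_of_inner_gradient_le D.V_contDiff hδ hbM (fun x hx => hW0 x (hRb.trans hx))
      (fun x hx => hW x (hRb.trans hx)) hξ.snd (fun t ht => (hξ' t ht).fst_snd.2)
      (fun t _ h1 => D.inner_gradient_observer_le _ h1.le) hz0 t ht

theorem exists_absorbing (D : ObserverDesign f S h V W R P μ K₁ kc Q ω b L c a p φ khat)
    (N : ℝ) : ∃ r T₁, 0 ≤ T₁ ∧ ∀ (θ π : ℕ → ℝ) (ξ : ℝ → E × E) (T : ℝ), Continuous ξ →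
      (∀ t ∈ Ico 0 T, HasDerivWithinAt ξ (loopField f h khat kc θ π ξ t) (Ici t) t) →
      ‖ξ 0‖ ≤ N → (∀ t ∈ Icc 0 T, ‖ξ t‖ ≤ r) ∧
        ∀ t ∈ Icc T₁ T, V (ξ t).1 ≤ R ∧ V (ξ t).2 ≤ b := by
  obtain ⟨C, hC⟩ := (isCompact_closedBall (0 : E) N).exists_bound_of_continuousOn
    D.V_contDiff.continuous.continuousOn
  set M := max b C
  obtain ⟨r, hr⟩ := (D.isCompact_sublevel M).isBounded.exists_norm_le
  obtain ⟨δ, hδ, hW⟩ := D.exists_le_W M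
  have hRb := D.R_lt_b
  have hR := D.R_pos
  have hbM : b ≤ M := le_max_left _ _
  refine ⟨r, M / δ, div_nonneg (by linarith) hδ.le, fun θ π ξ T hξ hξ' h0 => ?_⟩
  have hV0 : ∀ x : E, ‖x‖ ≤ N → V x ≤ M := fun x hx => (Real.le_norm_self _).trans
    ((hC x (mem_closedBall_zero_iff.2 hx)).trans (le_max_right _ _))
  have key := D.V_le_of_trajectory hξ hξ' hδ.le hW hbM (hV0 _ ((norm_fst_le _).trans h0))
    (hV0 _ ((norm_snd_le _).trans h0))
  refine ⟨fun t ht => ?_, fun t ht => ?_⟩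
  · have h1 : M - δ * t ≤ M := by linarith [mul_nonneg hδ.le ht.1]
    exact max_le (hr _ ((key t ht).1.trans (max_le (by linarith) h1)))
      (hr _ ((key t ht).2.trans (max_le hbM h1)))
  · have ht0 : 0 ≤ t := le_trans (div_nonneg (by linarith) hδ.le) ht.1
    have h1 : M ≤ δ * t := by
      have := (div_le_iff₀ hδ).1 ht.1
      linarith
    have h2 := key t ⟨ht0, ht.2⟩
    rwa [max_eq_left (by linarith), max_eq_left (by linarith)] at h2

end ObserverDesign

end Trajectories

section Convergence

theorem LocallyLipschitz.exists_norm_le {A B : Type*} [SeminormedAddCommGroup A]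
    [SeminormedAddCommGroup B] {G : A → B} (hG : LocallyLipschitz G) (hG0 : G 0 = 0) {s : Set A}
    (hs : IsCompact s) (h0 : 0 ∈ s) : ∃ K : ℝ, 0 ≤ K ∧ ∀ a ∈ s, ‖G a‖ ≤ K * ‖a‖ := by
  obtain ⟨K, hK0, hK⟩ := (hG.locallyLipschitzOn (s := s)).exists_norm_sub_le hs
  exact ⟨K, hK0, fun a ha => by simpa [hG0] using hK a ha 0 h0⟩

variable {E U Y : Type*} [NormedAddCommGroup E] [InnerProductSpace ℝ E] [FiniteDimensional ℝ E]
  [NormedAddCommGroup U] [NormedSpace ℝ U]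
  [NormedAddCommGroup Y] [NormedSpace ℝ Y]

namespace ObserverDesign

variable {f : E → U → E} {S : Set U} {h : E → Y} {V W : E → ℝ} {R : ℝ} {P : E → ℝ} {μ K₁ : ℝ}
  {kc : E → U} {Q : E →L[ℝ] E} {ω b : ℝ} {L : Y →L[ℝ] E} {c a : ℝ} {p : ℝ → ℝ}
  {φ : E → Y → U → ℝ} {khat : E → Y → U → E}

theorem exists_sampling_error_le [CompleteSpace Y]
    (D : ObserverDesign f S h V W R P μ K₁ kc Q ω b L c a p φ khat) (r : ℝ) :
    ∃ κ, 0 ≤ κ ∧ ∀ Δ ≤ (1 / 3 : ℝ), ∀ θ π, IsPartition θ → IsPartition π →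
      (∀ i, θ (i + 1) - θ i ≤ Δ) → (∀ i, π (i + 1) - π i ≤ Δ) → ∀ ξ : ℝ → E × E, Continuous ξ →
      (∀ t, 0 ≤ t → HasDerivWithinAt ξ (loopField f h khat kc θ π ξ t) (Ici t) t) →
      ∀ t s, 1 ≤ t → (∀ v ∈ Icc (t - 1) t, ‖ξ v‖ ≤ s ∧ ‖ξ v‖ ≤ r) →
      ‖predOutput f h π (holdInput kc θ fun v => (ξ v).2) (fun v => (ξ v).1) (fun v => (ξ v).2) t -
        h (ξ t).1‖ ≤ κ * (Δ * s) ∧ ‖(ξ (θ (cellIdx θ t))).2 - (ξ t).2‖ ≤ κ * (Δ * s) := by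
  rcases lt_or_ge r 0 with hr | hr
  · refine ⟨0, le_rfl, fun Δ _ θ π _ _ _ _ ξ _ _ t s _ hs => ?_⟩
    have := (norm_nonneg _).trans (hs t ⟨by linarith, le_rfl⟩).2
    linarith
  have H := D.loopRegular
  have hB : IsCompact (Metric.closedBall (0 : E) r) := isCompact_closedBall _ _
  have h0 : (0 : E) ∈ Metric.closedBall (0 : E) r := Metric.mem_closedBall_self hr
  have hS0 : (0 : U) ∈ S := D.kc_zero ▸ D.kc_mem 0
  have h00 : (0 : E × U) ∈ Metric.closedBall (0 : E) r ×ˢ S := ⟨h0, hS0⟩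
  obtain ⟨Kf, hKf0, hKf⟩ := H.f_contDiff.locallyLipschitz.exists_norm_le H.f_zero
    (hB.prod D.isCompact) h00
  obtain ⟨Kd, hKd0, hKd⟩ := H.rate_contDiff.locallyLipschitz.exists_norm_le H.rate_zero
    (hB.prod D.isCompact) h00
  obtain ⟨Kh, hKh0, hKh⟩ := H.h_contDiff.locallyLipschitz.exists_norm_le H.h_zero hB h0
  obtain ⟨Kk, hKk0, hKk⟩ := D.kc_lip.exists_norm_le D.kc_zero hB h0
  set κ₁ := 2 * (Kd * (1 + Kk)) with hκ₁
  set κ₂ := Kf * (1 + Kk) + 2 * (‖L‖ * (2 * Kh + κ₁)) with hκ₂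
  have hκ₁0 : 0 ≤ κ₁ := by positivity
  have hκ₂0 : 0 ≤ κ₂ := by positivity
  refine ⟨κ₁ + κ₂, by positivity, fun Δ hΔ θ π hθ hπ hθΔ hπΔ ξ hξ hξ' t s ht hs => ?_⟩
  set u := holdInput kc θ fun v => (ξ v).2 with hu_def
  set w := predOutput f h π u (fun v => (ξ v).1) fun v => (ξ v).2 with hw_def
  have hs0 : 0 ≤ s := (norm_nonneg _).trans (hs t ⟨by linarith, le_rfl⟩).1
  have hΔ0 : 0 ≤ Δ := (sub_nonneg.2 (hθ.strictMono.monotone (Nat.le_succ 0))).trans (hθΔ 0)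
  have hxs : ∀ v ∈ Icc (t - 1) t, ‖(ξ v).1‖ ≤ s ∧ (ξ v).1 ∈ Metric.closedBall (0 : E) r :=
    fun v hv => ⟨(norm_fst_le _).trans (hs v hv).1,
      mem_closedBall_zero_iff.2 ((norm_fst_le _).trans (hs v hv).2)⟩
  have hzs : ∀ v ∈ Icc (t - 1) t, ‖(ξ v).2‖ ≤ s ∧ (ξ v).2 ∈ Metric.closedBall (0 : E) r :=
    fun v hv => ⟨(norm_snd_le _).trans (hs v hv).1,
      mem_closedBall_zero_iff.2 ((norm_snd_le _).trans (hs v hv).2)⟩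
  have hu : ∀ v ∈ Icc (t - 2 / 3) t, ‖u v‖ ≤ Kk * s := fun v hv => by
    have h1 := hθ.lt_succ v
    have h2 := hθ.le_self (t := v) (by linarith [hv.1])
    have h3 := hzs (θ (cellIdx θ v)) ⟨by linarith [hθΔ (cellIdx θ v), hv.1], h2.trans hv.2⟩
    exact (hKk _ h3.2).trans (mul_le_mul_of_nonneg_left h3.1 hKk0)
  have hpair : ∀ y : E, ‖y‖ ≤ s → ∀ v ∈ Icc (t - 2 / 3) t, ‖(y, u v)‖ ≤ (1 + Kk) * s :=
    fun y hy v hv => (LoopRegular.norm_prodMk_le_add _ _).trans (by linarith [hu v hv])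
  have hw : ∀ v ∈ Icc (t - 1 / 3) t, ‖w v - h (ξ v).1‖ ≤ κ₁ * (Δ * s) := fun v hv => by
    have h1 := hπ.lt_succ v
    have hv0 : 0 ≤ v := by linarith [hv.1]
    have h2 := hπ.le_self hv0
    have h3 : v - π (cellIdx π v) ≤ Δ := by linarith [hπΔ (cellIdx π v)]
    have h4 := H.norm_predOutput_sub_le hθ hπ hξ.fst hξ.snd hv0 (M := κ₁ * s)
      (fun y hy => (hξ' y hy.1).fst_snd.1) (fun y hy => by
        have hy1 : y ∈ Icc (t - 2 / 3) t := ⟨by linarith [hy.1, hv.1], hy.2.trans hv.2⟩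
        have hy2 : y ∈ Icc (t - 1) t := ⟨by linarith [hy1.1], hy1.2⟩
        have h5 := (hKd ((ξ y).2, u y) ⟨(hzs y hy2).2, D.kc_mem _⟩).trans
          (mul_le_mul_of_nonneg_left (hpair _ (hzs y hy2).1 y hy1) hKd0)
        have h6 := (hKd ((ξ y).1, u y) ⟨(hxs y hy2).2, D.kc_mem _⟩).trans
          (mul_le_mul_of_nonneg_left (hpair _ (hxs y hy2).1 y hy1) hKd0)
        refine (norm_sub_le _ _).trans ((add_le_add h5 h6).trans (le_of_eq ?_))
        rw [hκ₁]
        ring)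
    refine h4.trans ((mul_le_mul_of_nonneg_left h3 (by positivity)).trans (le_of_eq (by ring)))
  have hzd : ∀ v ∈ Icc (t - 1 / 3) t,
      ‖f (ξ v).2 (u v) + khat (ξ v).2 (w v) (u v)‖ ≤ κ₂ * s := fun v hv => by
    have hv1 : v ∈ Icc (t - 2 / 3) t := ⟨by linarith [hv.1], hv.2⟩
    have hv2 : v ∈ Icc (t - 1) t := ⟨by linarith [hv.1], hv.2⟩
    have h1 := (hKf ((ξ v).2, u v) ⟨(hzs v hv2).2, D.kc_mem _⟩).trans
      (mul_le_mul_of_nonneg_left (hpair _ (hzs v hv2).1 v hv1) hKf0)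
    have h2 := D.norm_khat_le (ξ v).2 (w v) (D.kc_mem _ : u v ∈ S)
    have h3 : ‖h (ξ v).2 - w v‖ ≤ (2 * Kh + κ₁) * s := by
      have e1 := (hKh _ (hzs v hv2).2).trans (mul_le_mul_of_nonneg_left (hzs v hv2).1 hKh0)
      have e2 := (hKh _ (hxs v hv2).2).trans (mul_le_mul_of_nonneg_left (hxs v hv2).1 hKh0)
      have e3 := hw v hv
      have e4 : κ₁ * (Δ * s) ≤ κ₁ * s := mul_le_mul_of_nonneg_left
        (mul_le_of_le_one_left hs0 (by linarith)) hκ₁0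
      have e5 : h (ξ v).2 - w v = h (ξ v).2 - (h (ξ v).1 + (w v - h (ξ v).1)) := by abel
      rw [e5]
      refine (norm_sub_le _ _).trans ((add_le_add le_rfl (norm_add_le _ _)).trans ?_)
      linarith
    have h4 := (L.le_opNorm (h (ξ v).2 - w v)).trans (mul_le_mul_of_nonneg_left h3 (norm_nonneg L))
    refine (norm_add_le _ _).trans ((add_le_add h1 h2).trans ?_)
    rw [hκ₂]
    linarith
  refine ⟨(hw t ⟨by linarith, le_rfl⟩).trans
    (mul_le_mul_of_nonneg_right (by linarith) (by positivity)), ?_⟩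
  have ht0 : 0 ≤ t := by linarith
  have h1 := hθ.lt_succ t
  have h2 := hθ.le_self ht0
  have h3 : t - θ (cellIdx θ t) ≤ Δ := by linarith [hθΔ (cellIdx θ t)]
  have h4 := norm_image_sub_le_of_norm_deriv_right_le_segment (f := fun v => (ξ v).2)
    hξ.snd.continuousOn (fun v hv => (hξ' v ((hθ.nonneg _).trans hv.1)).fst_snd.2)
    (fun v hv => hzd v ⟨by linarith [hv.1], hv.2.le⟩) t (right_mem_Icc.2 h2)
  rw [norm_sub_rev]
  calc _ ≤ κ₂ * s * (t - θ (cellIdx θ t)) := h4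
    _ ≤ κ₂ * s * Δ := mul_le_mul_of_nonneg_left h3 (by positivity)
    _ = κ₂ * (Δ * s) := by ring
    _ ≤ _ := mul_le_mul_of_nonneg_right (by linarith) (by positivity)

theorem hasDerivWithinAt_errorLyapunov
    (D : ObserverDesign f S h V W R P μ K₁ kc Q ω b L c a p φ khat) (ρ : ℝ) {ξ : ℝ → E × E}
    {ξ' : E × E} {s : Set ℝ} {t : ℝ} (hξ : HasDerivWithinAt ξ ξ' s t) :
    HasDerivWithinAt (fun t => errorLyapunov P Q ρ (ξ t)) (⟪gradient P (ξ t).1, ξ'.1⟫ +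
      2 * ρ * ⟪Q ((ξ t).2 - (ξ t).1), ξ'.2 - ξ'.1⟫) s t := by
  have he := hξ.fst_snd.2.sub hξ.fst_snd.1
  have hQe := Q.hasFDerivAt.comp_hasDerivWithinAt t he
  refine ((HasDerivWithinAt.comp_gradient D.P_contDiff hξ.fst_snd.1).add
    ((he.inner ℝ hQe).const_mul ρ)).congr_deriv ?_
  have h1 := D.Q_symm ((ξ t).2 - (ξ t).1) (ξ'.2 - ξ'.1)
  have h2 := real_inner_comm (ξ'.2 - ξ'.1) (Q ((ξ t).2 - (ξ t).1))
  simp only [Pi.sub_apply, Function.comp_apply] at *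
  rw [← h1, ← h2]
  ring

theorem exists_exponential_decay [CompleteSpace Y]
    (D : ObserverDesign f S h V W R P μ K₁ kc Q ω b L c a p φ khat) :
    ∃ Δ σ A : ℝ, 0 < Δ ∧ Δ ≤ 1 / 3 ∧ 0 < σ ∧ 0 ≤ A ∧ ∀ θ π, IsPartition θ → IsPartition π →
      (∀ i, θ (i + 1) - θ i ≤ Δ) → (∀ i, π (i + 1) - π i ≤ Δ) → ∀ ξ : ℝ → E × E, Continuous ξ →
      (∀ t, 0 ≤ t → HasDerivWithinAt ξ (loopField f h khat kc θ π ξ t) (Ici t) t) →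
      ∀ T₁ M, 0 ≤ T₁ → (∀ t, T₁ ≤ t → V (ξ t).1 ≤ R ∧ V (ξ t).2 ≤ b) →
      (∀ t ∈ Icc T₁ (T₁ + 1), ‖ξ t‖ ≤ M) →
      ∀ t, T₁ ≤ t → ‖ξ t‖ ≤ A * M * Real.exp (-σ * (t - (T₁ + 1))) := by
  obtain ⟨r, hr⟩ := (D.isCompact_sublevel b).isBounded.exists_norm_le
  replace hr : ∀ x, V x ≤ b → ‖x‖ ≤ r := fun x hx => hr x hx
  obtain ⟨ρ, α, κ, q, q', hα, hκ, hq, hq', hdiss⟩ := D.exists_dissipation hr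
  obtain ⟨κd, hκd, herr⟩ := D.exists_sampling_error_le r
  set B := 2 * κ * κd ^ 2 / q
  have hB : 0 ≤ B := by positivity
  set Δ := min (1 / 3) (α / (4 * (B * Real.exp (α / 2)) + 1))
  have hΔ : 0 < Δ := by positivity
  have hΔ3 : Δ ≤ 1 / 3 := min_le_left _ _
  have hΔB : 4 * (B * Δ * Real.exp (α / 2)) ≤ α := by
    have := (le_div_iff₀ (by positivity)).1
      (min_le_right (1 / 3) (α / (4 * (B * Real.exp (α / 2)) + 1)))
    linarith
  refine ⟨Δ, α / 4, √(q' / q), hΔ, hΔ3, by positivity, by positivity, ?_⟩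
  intro θ π hθ hπ hθΔ hπΔ ξ hξ hξ' T₁ M hT₁ hV hM t ht
  have hM0 : 0 ≤ M := (norm_nonneg _).trans (hM T₁ ⟨le_rfl, by linarith⟩)
  have hlow := fun s (hs : T₁ ≤ s) => (hdiss (ξ s) (hV s hs).1 (hV s hs).2).1
  have hup := fun s (hs : T₁ ≤ s) => (hdiss (ξ s) (hV s hs).1 (hV s hs).2).2.1
  have hcont : Continuous fun s => errorLyapunov P Q ρ (ξ s) := by
    have h1 : Continuous fun s => P (ξ s).1 := D.P_contDiff.continuous.comp hξ.fst
    have h2 : Continuous fun s => (ξ s).2 - (ξ s).1 := hξ.snd.sub hξ.fst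
    exact h1.add (continuous_const.mul (h2.inner (Q.continuous.comp h2)))
  have hdecay := halanay (y := fun s => errorLyapunov P Q ρ (ξ s)) (T₁ := T₁) (α := α)
    (β := B * Δ) (σ := α / 2) (M := q' * M ^ 2) (by positivity) (by linarith)
    hΔB (fun s hs => le_trans (by positivity) (hlow s hs)) hcont.continuousOn
    (fun s hs => D.hasDerivWithinAt_errorLyapunov ρ (hξ' s (by linarith)))
    (fun s hs N hN => by
      have hs1 : T₁ ≤ s := by linarith
      have hN0 : 0 ≤ N := (le_trans (by positivity) (hlow s hs1)).trans
        (hN s ⟨by linarith, le_rfl⟩)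
      have hbd : ∀ v ∈ Icc (s - 1) s, ‖ξ v‖ ≤ √(N / q) ∧ ‖ξ v‖ ≤ r := fun v hv => by
        have hv1 : T₁ ≤ v := by linarith [hv.1]
        refine ⟨Real.le_sqrt_of_sq_le ((le_div_iff₀ hq).2 ?_), max_le
          (hr _ ((hV v hv1).1.trans D.R_lt_b.le)) (hr _ (hV v hv1).2)⟩
        rw [mul_comm]
        exact (hlow v hv1).trans (hN v hv)
      obtain ⟨e1, e2⟩ := herr Δ hΔ3 θ π hθ hπ hθΔ hπΔ ξ hξ hξ' s _ (by linarith) hbd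
      have hs0 : 0 ≤ s := by linarith
      have hθs : θ (cellIdx θ s) ∈ Icc (s - 1) s := by
        have := hθ.lt_succ s
        exact ⟨by linarith [hθΔ (cellIdx θ s)], hθ.le_self hs0⟩
      have hd := (hdiss (ξ s) (hV s hs1).1 (hV s hs1).2).2.2
        (predOutput f h π (holdInput kc θ fun v => (ξ v).2) (fun v => (ξ v).1)
          (fun v => (ξ v).2) s) (ξ (θ (cellIdx θ s))).2
        ((norm_snd_le _).trans (hbd _ hθs).2)
      refine hd.trans (add_le_add le_rfl ?_)
      have e1' := pow_le_pow_left₀ (norm_nonneg _) e1 2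
      have e2' := pow_le_pow_left₀ (norm_nonneg _) e2 2
      have hsq : √(N / q) ^ 2 = N / q := Real.sq_sqrt (by positivity)
      calc _ ≤ κ * ((κd * (Δ * √(N / q))) ^ 2 + (κd * (Δ * √(N / q))) ^ 2) :=
            mul_le_mul_of_nonneg_left (add_le_add e1' e2') hκ.le
        _ = 2 * κ * κd ^ 2 * (√(N / q) ^ 2) * (Δ * Δ) := by ring
        _ = B * N * (Δ * Δ) := by rw [hsq]; simp only [B]; ring
        _ ≤ B * N * (Δ * 1) := by gcongr; linarith
        _ = B * Δ * N := by ring)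
    (fun s hs => (hup s hs.1).trans (mul_le_mul_of_nonneg_left
      (pow_le_pow_left₀ (norm_nonneg _) (hM s hs) 2) hq'.le)) t ht
  refine (sq_le_sq₀ (norm_nonneg _) (by positivity)).1 ?_
  have h1 := (hlow t ht).trans hdecay
  have h2 : (√(q' / q) * M * Real.exp (-(α / 4) * (t - (T₁ + 1)))) ^ 2 =
      q' / q * M ^ 2 * Real.exp (-(α / 2) * (t - (T₁ + 1))) := by
    rw [mul_pow, mul_pow, Real.sq_sqrt (by positivity), ← Real.exp_nat_mul]
    congr 2
    push_cast
    ring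
  rw [h2]
  refine le_of_mul_le_mul_left (h1.trans (le_of_eq ?_)) hq
  field_simp

end ObserverDesign

end Convergence

section UniformDecay

variable {E U Y : Type*} [NormedAddCommGroup E] [InnerProductSpace ℝ E] [FiniteDimensional ℝ E]
  [NormedAddCommGroup U] [NormedSpace ℝ U] [FiniteDimensional ℝ U]
  [NormedAddCommGroup Y] [NormedSpace ℝ Y] [FiniteDimensional ℝ Y]

namespace ObserverDesign

variable {f : E → U → E} {S : Set U} {h : E → Y} {V W : E → ℝ} {R : ℝ} {P : E → ℝ} {μ K₁ : ℝ}
  {kc : E → U} {Q : E →L[ℝ] E} {ω b : ℝ} {L : Y →L[ℝ] E} {c a : ℝ} {p : ℝ → ℝ}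
  {φ : E → Y → U → ℝ} {khat : E → Y → U → E}

theorem exists_uniform_decay
    (D : ObserverDesign f S h V W R P μ K₁ kc Q ω b L c a p φ khat) :
    ∃ Δ σ : ℝ, ∃ Γ : ℕ → ℝ, 0 < Δ ∧ Δ ≤ 1 ∧ 0 < σ ∧ ∀ θ π, IsPartition θ → IsPartition π →
      (∀ i, θ (i + 1) - θ i ≤ Δ) → (∀ i, π (i + 1) - π i ≤ Δ) → ∀ (ξ : ℝ → E × E) (ξ₀ : E × E),
      Continuous ξ →
      (∀ t, 0 ≤ t → ξ t = ξ₀ + ∫ s in (0 : ℝ)..t, loopField f h khat kc θ π ξ s) →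
      ∀ N : ℕ, ‖ξ₀‖ ≤ N → ∀ t, 0 ≤ t → ‖ξ t‖ ≤ Real.exp (-σ * t) * (Γ N * ‖ξ₀‖) := by
  obtain ⟨Δ, σ, A, hΔ, hΔ3, hσ, hA, hdecay⟩ := D.exists_exponential_decay
  have H := D.loopRegular
  choose r T₁ hT₁ habs using fun N : ℕ => D.exists_absorbing (N : ℝ)
  choose K hK hlip using fun N => H.exists_causalLipschitz (r N)
  refine ⟨Δ, σ, fun N => (1 + A) * (2 * Real.exp (2 * K N * (T₁ N + 1))) *
    Real.exp (σ * (T₁ N + 1)), hΔ, by linarith, hσ, ?_⟩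
  intro θ π hθ hπ hθΔ hπΔ ξ ξ₀ hξ hsol N hN t ht
  have hπ1 : ∀ i, π (i + 1) - π i ≤ 1 := fun i => (hπΔ i).trans (by linarith)
  have hξ0 : ξ 0 = ξ₀ := by simpa using hsol 0 le_rfl
  have hξ' : ∀ t, 0 ≤ t → HasDerivWithinAt ξ (loopField f h khat kc θ π ξ t) (Ici t) t :=
    fun t ht => H.hasDerivWithinAt_of_eq_integral hθ hπ hπ1 hξ (T := t + 1)
      (fun s hs => hsol s hs.1) t ⟨ht, by linarith⟩
  have habs' := fun T => habs N θ π ξ T hξ (fun t ht => hξ' t ht.1) (hξ0 ▸ hN)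
  have hbound := fun s (hs : 0 ≤ s) => (habs' s).1 s ⟨hs, le_rfl⟩
  set B := 2 * Real.exp (2 * K N * (T₁ N + 1))
  have hM : ∀ s ∈ Icc 0 (T₁ N + 1), ‖ξ s‖ ≤ B * ‖ξ₀‖ := fun s hs => by
    refine (norm_le_exp_of_causal_bound (hK N) (T := s) hξ.continuousOn
      (fun v hv => hsol v hv.1) (fun v hv d hd => ?_) s ⟨hs.1, le_rfl⟩).trans ?_
    · refine ((hlip N θ π hθ hπ hπ1).norm_le (fun t _ => H.loopField_zero θ π t) hξ hv.1
        (min_le_right d (r N)) fun y hy => le_min (hd y hy) (hbound y hy.1)).trans ?_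
      exact mul_le_mul_of_nonneg_left (min_le_left _ _) (hK N).le
    · have := hK N
      simp only [B]
      gcongr
      exact hs.2
  have hexp : Real.exp (-σ * (t - (T₁ N + 1))) = Real.exp (σ * (T₁ N + 1)) * Real.exp (-σ * t) := by
    rw [← Real.exp_add]
    congr 1
    ring
  have hB : 0 ≤ B * ‖ξ₀‖ := by positivity
  have hE := (Real.exp_pos (-σ * (t - (T₁ N + 1)))).le
  suffices hmain : ‖ξ t‖ ≤ (1 + A) * (B * ‖ξ₀‖) * Real.exp (-σ * (t - (T₁ N + 1))) by
    rw [hexp] at hmain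
    exact hmain.trans (le_of_eq (by ring))
  rcases le_total t (T₁ N) with h1 | h1
  · have h2 : 1 ≤ Real.exp (-σ * (t - (T₁ N + 1))) := Real.one_le_exp (by nlinarith)
    calc ‖ξ t‖ ≤ 1 * (B * ‖ξ₀‖) * 1 := by simpa using hM t ⟨ht, by linarith⟩
      _ ≤ _ := by gcongr; linarith
  · refine (hdecay θ π hθ hπ hθΔ hπΔ ξ hξ hξ' (T₁ N) (B * ‖ξ₀‖) (hT₁ N)
      (fun s hs => (habs' s).2 s ⟨hs, le_rfl⟩)
      (fun s hs => hM s ⟨(hT₁ N).trans hs.1, hs.2⟩) t h1).trans ?_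
    gcongr
    linarith

theorem exists_eq_integral_loopField
    (D : ObserverDesign f S h V W R P μ K₁ kc Q ω b L c a p φ khat) {θ π : ℕ → ℝ}
    (hθ : IsPartition θ) (hπ : IsPartition π) (hπ1 : ∀ i, π (i + 1) - π i ≤ 1) (ξ₀ : E × E) :
    ∃ ξ : ℝ → E × E, Continuous ξ ∧
      ∀ t, 0 ≤ t → ξ t = ξ₀ + ∫ s in (0 : ℝ)..t, loopField f h khat kc θ π ξ s := by
  have H := D.loopRegular
  obtain ⟨r, T₁, -, hr⟩ := D.exists_absorbing ‖ξ₀‖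
  refine exists_volterra_of_apriori (r := r)
    (fun r => (H.exists_causalLipschitz r).imp fun K hK => ⟨hK.1, hK.2 θ π hθ hπ hπ1⟩)
    (fun t _ => H.loopField_zero θ π t)
    (fun ξ hξ => (H.stronglyMeasurable_loopField hθ hπ hξ).aestronglyMeasurable) ?_
  intro T hT ξ hξ hsol
  have hξ0 : ξ 0 = ξ₀ := by simpa using hsol 0 (left_mem_Icc.2 hT)
  exact (hr θ π ξ T hξ (H.hasDerivWithinAt_of_eq_integral hθ hπ hπ1 hξ hsol)
    (congrArg norm hξ0).le).1

end ObserverDesign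

end UniformDecay

section ClosedLoopEquivalence

theorem isPartition_natCast_mul {T : ℝ} (hT : 0 < T) : IsPartition fun j : ℕ => (j : ℝ) * T where
  zero := by simp
  strictMono := fun i j hij => mul_lt_mul_of_pos_right (Nat.cast_lt.2 hij) hT
  tendsto := tendsto_natCast_atTop_atTop.atTop_mul_const hT

theorem loopField_congr {E U Y : Type*} [NormedAddCommGroup E] [NormedSpace ℝ E]
    [NormedAddCommGroup U] [NormedSpace ℝ U] [NormedAddCommGroup Y] [NormedSpace ℝ Y]
    {f : E → U → E} {h : E → Y} {khat : E → Y → U → E} {kc : E → U} {θ π : ℕ → ℝ}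
    (hθ : IsPartition θ) (hπ : IsPartition π) {ξ ξ' : ℝ → E × E} (hξ : EqOn ξ ξ' (Ici 0))
    {t : ℝ} (ht : 0 ≤ t) : loopField f h khat kc θ π ξ t = loopField f h khat kc θ π ξ' t := by
  have hu : ∀ s, holdInput kc θ (fun s => (ξ s).2) s = holdInput kc θ (fun s => (ξ' s).2) s :=
    fun s => by simp only [holdInput, hξ (hθ.nonneg (cellIdx θ s))]
  have hw : predOutput f h π (holdInput kc θ fun s => (ξ s).2) (fun s => (ξ s).1)
      (fun s => (ξ s).2) t = predOutput f h π (holdInput kc θ fun s => (ξ' s).2)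
        (fun s => (ξ' s).1) (fun s => (ξ' s).2) t := by
    simp only [predOutput, hξ (hπ.nonneg (cellIdx π t))]
    congr 1
    refine intervalIntegral.integral_congr fun s hs => ?_
    rw [uIcc_of_le (hπ.le_self ht)] at hs
    simp only [hu, hξ (show s ∈ Ici 0 from (hπ.nonneg _).trans hs.1)]
  simp only [loopField, hw, hu, hξ (show t ∈ Ici 0 from ht)]

variable {n m k : ℕ}
  {f : EuclideanSpace ℝ (Fin n) → EuclideanSpace ℝ (Fin m) → EuclideanSpace ℝ (Fin n)}
  {h : EuclideanSpace ℝ (Fin n) → EuclideanSpace ℝ (Fin k)}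
  {khat : EuclideanSpace ℝ (Fin n) → EuclideanSpace ℝ (Fin k) → EuclideanSpace ℝ (Fin m) →
    EuclideanSpace ℝ (Fin n)}
  {kc : EuclideanSpace ℝ (Fin n) → EuclideanSpace ℝ (Fin m)}
  {S : Set (EuclideanSpace ℝ (Fin m))} {T : ℝ} {π : ℕ → ℝ}
  {z₀ x₀ : EuclideanSpace ℝ (Fin n)} {x z : ℝ → EuclideanSpace ℝ (Fin n)}
  {w : ℝ → EuclideanSpace ℝ (Fin k)} {u : ℝ → EuclideanSpace ℝ (Fin m)}

namespace LoopRegular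

theorem integral_loopField (H : LoopRegular f h khat kc S) {θ : ℕ → ℝ} (hθ : IsPartition θ)
    (hπ : IsPartition π) (hπ1 : ∀ i, π (i + 1) - π i ≤ 1)
    {ξ : ℝ → EuclideanSpace ℝ (Fin n) × EuclideanSpace ℝ (Fin n)} (hξ : Continuous ξ) {t : ℝ}
    (ht : 0 ≤ t) : ∫ s in (0 : ℝ)..t, loopField f h khat kc θ π ξ s =
      (∫ s in (0 : ℝ)..t, (loopField f h khat kc θ π ξ s).1,
        ∫ s in (0 : ℝ)..t, (loopField f h khat kc θ π ξ s).2) := by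
  have hint := H.loopField_intervalIntegrable hθ hπ hπ1 hξ ht
  exact Prod.ext ((ContinuousLinearMap.fst ℝ _ _).intervalIntegral_comp_comm hint).symm
    ((ContinuousLinearMap.snd ℝ _ _).intervalIntegral_comp_comm hint).symm

theorem isClosedLoopSolDF (H : LoopRegular f h khat kc S) (hT : 0 < T) (hπ : IsPartition π)
    (hπ1 : ∀ i, π (i + 1) - π i ≤ 1)
    {ξ : ℝ → EuclideanSpace ℝ (Fin n) × EuclideanSpace ℝ (Fin n)} (hξ : Continuous ξ)
    (hsol : ∀ t, 0 ≤ t → ξ t = (x₀, z₀) +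
      ∫ s in (0 : ℝ)..t, loopField f h khat kc (fun j : ℕ => (j : ℝ) * T) π ξ s) :
    IsClosedLoopSolDF f h khat kc T π z₀ x₀ (fun t => (ξ t).1) (fun t => (ξ t).2)
      (predOutput f h π (holdInput kc (fun j : ℕ => (j : ℝ) * T) fun t => (ξ t).2)
        (fun t => (ξ t).1) fun t => (ξ t).2)
      (holdInput kc (fun j : ℕ => (j : ℝ) * T) fun t => (ξ t).2) := by
  have hθ := isPartition_natCast_mul hT
  have hξ0 : ξ 0 = (x₀, z₀) := by simpa using hsol 0 le_rfl
  have hsol' := fun t (ht : 0 ≤ t) =>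
    (hsol t ht).trans (congrArg _ (H.integral_loopField hθ hπ hπ1 hξ ht))
  refine ⟨hξ.fst.continuousOn, congrArg Prod.fst hξ0, fun t ht => congrArg Prod.fst (hsol' t ht),
    hξ.snd.continuousOn, congrArg Prod.snd hξ0, fun t ht => congrArg Prod.snd (hsol' t ht),
    fun i t ht => ?_, fun j t ht => ?_⟩
  · simp only [predOutput, hπ.cellIdx_eq ht, outputRate]
  · have hj : cellIdx (fun j : ℕ => (j : ℝ) * T) t = j := hθ.cellIdx_eq (by simpa using ht)
    simp only [holdInput, hj]

end LoopRegular

namespace IsClosedLoopSolDF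

theorem input_eq (hs : IsClosedLoopSolDF f h khat kc T π z₀ x₀ x z w u) (hT : 0 < T) {t : ℝ}
    (ht : 0 ≤ t) : u t = holdInput kc (fun j : ℕ => (j : ℝ) * T) z t := by
  have hθ := isPartition_natCast_mul hT
  obtain ⟨-, -, -, -, -, -, -, hu⟩ := hs
  exact hu _ t ⟨hθ.le_self ht, by simpa using hθ.lt_succ t⟩

theorem output_eq (hs : IsClosedLoopSolDF f h khat kc T π z₀ x₀ x z w u) (hT : 0 < T)
    (hπ : IsPartition π) {t : ℝ} (ht : 0 ≤ t) :
    w t = predOutput f h π (holdInput kc (fun j : ℕ => (j : ℝ) * T) z) x z t := by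
  have hw := hs.2.2.2.2.2.2.1 _ t ⟨hπ.le_self ht, hπ.lt_succ t⟩
  rw [hw, predOutput]
  congr 1
  refine intervalIntegral.integral_congr fun s hs' => ?_
  rw [uIcc_of_le (hπ.le_self ht)] at hs'
  simp only [outputRate, hs.input_eq hT ((hπ.nonneg _).trans hs'.1)]

theorem eq_integral_loopField (hs : IsClosedLoopSolDF f h khat kc T π z₀ x₀ x z w u)
    (H : LoopRegular f h khat kc S) (hT : 0 < T) (hπ : IsPartition π)
    (hπ1 : ∀ i, π (i + 1) - π i ≤ 1)
    {ξ : ℝ → EuclideanSpace ℝ (Fin n) × EuclideanSpace ℝ (Fin n)} (hξ : Continuous ξ)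
    (hξs : ∀ t, 0 ≤ t → ξ t = (x t, z t)) {t : ℝ} (ht : 0 ≤ t) : ξ t = (x₀, z₀) +
      ∫ s in (0 : ℝ)..t, loopField f h khat kc (fun j : ℕ => (j : ℝ) * T) π ξ s := by
  have hθ := isPartition_natCast_mul hT
  have hfield : ∀ s ∈ uIcc 0 t, loopField f h khat kc (fun j : ℕ => (j : ℝ) * T) π ξ s =
      (f (x s) (u s), f (z s) (u s) + khat (z s) (w s) (u s)) := fun s hs' => by
    rw [uIcc_of_le ht] at hs'
    rw [loopField_congr hθ hπ (ξ' := fun t => (x t, z t)) hξs hs'.1, hs.input_eq hT hs'.1,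
      hs.output_eq hT hπ hs'.1]
    rfl
  rw [H.integral_loopField hθ hπ hπ1 hξ ht, hξs t ht, hs.2.2.1 t ht, hs.2.2.2.2.2.1 t ht,
    intervalIntegral.integral_congr fun s hs' => congrArg Prod.fst (hfield s hs'),
    intervalIntegral.integral_congr fun s hs' => congrArg Prod.snd (hfield s hs')]
  rfl

end IsClosedLoopSolDF

namespace LoopRegular

theorem closedLoopSol_unique (H : LoopRegular f h khat kc S) (hT : 0 < T) (hπ : IsPartition π)
    (hπ1 : ∀ i, π (i + 1) - π i ≤ 1)
    {x' z' : ℝ → EuclideanSpace ℝ (Fin n)} {w' : ℝ → EuclideanSpace ℝ (Fin k)}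
    {u' : ℝ → EuclideanSpace ℝ (Fin m)}
    (hs : IsClosedLoopSolDF f h khat kc T π z₀ x₀ x z w u)
    (hs' : IsClosedLoopSolDF f h khat kc T π z₀ x₀ x' z' w' u') {t : ℝ} (ht : 0 ≤ t) :
    x' t = x t ∧ z' t = z t ∧ w' t = w t ∧ u' t = u t := by
  have hθ := isPartition_natCast_mul hT
  have hmax : Continuous fun t : ℝ => max t 0 := continuous_id.max continuous_const
  have hcont : ∀ {v : ℝ → EuclideanSpace ℝ (Fin n)}, ContinuousOn v (Ici 0) →
      Continuous fun t => v (max t 0) := fun hv =>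
    hv.comp_continuous hmax fun _ => mem_Ici.2 (le_max_right _ _)
  have hξ := (hcont hs.1).prodMk (hcont hs.2.2.2.1)
  have hξ' := (hcont hs'.1).prodMk (hcont hs'.2.2.2.1)
  have hxz : ∀ t, 0 ≤ t → x t = x' t ∧ z t = z' t := fun t ht => by
    have := volterra_unique
      (fun r => (H.exists_causalLipschitz r).imp fun K hK => ⟨hK.1, hK.2 _ π hθ hπ hπ1⟩)
      (fun t _ => H.loopField_zero _ π t)
      (fun ξ hξ => (H.stronglyMeasurable_loopField hθ hπ hξ).aestronglyMeasurable) hξ hξ'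
      (fun t ht => hs.eq_integral_loopField H hT hπ hπ1 hξ
        (fun s hs => by simp only [max_eq_left hs]) ht)
      (fun t ht => hs'.eq_integral_loopField H hT hπ hπ1 hξ'
        (fun s hs => by simp only [max_eq_left hs]) ht) t ht
    simpa [max_eq_left ht] using this
  have hu : ∀ s, holdInput kc (fun j : ℕ => (j : ℝ) * T) z' s =
      holdInput kc (fun j : ℕ => (j : ℝ) * T) z s := fun s => by
    simp only [holdInput, (hxz _ (hθ.nonneg (cellIdx (fun j : ℕ => (j : ℝ) * T) s))).2]
  refine ⟨(hxz t ht).1.symm, (hxz t ht).2.symm, ?_, ?_⟩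
  · rw [hs.output_eq hT hπ ht, hs'.output_eq hT hπ ht]
    simp only [predOutput, (hxz _ (hπ.nonneg (cellIdx π t))).1]
    congr 1
    refine intervalIntegral.integral_congr fun s hs' => ?_
    rw [uIcc_of_le (hπ.le_self ht)] at hs'
    simp only [hu, (hxz s ((hπ.nonneg _).trans hs'.1)).2]
  · rw [hs.input_eq hT ht, hs'.input_eq hT ht, hu]

end LoopRegular

end ClosedLoopEquivalence

/-- Corollary 2.3: under (H1)–(H4) with `r = τ = 0`, for sufficiently
small `T_s, T_H > 0` there exist a locally Lipschitz `K∞` function `C` and `σ > 0` such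
that for every partition with steps `≤ T_s` and all `z₀, x₀ ∈ ℝⁿ`, the delay-free
sampled-data closed loop has a unique solution defined for all `t ≥ 0`, satisfying
`|x(t)| + |z(t)| ≤ e^{−σt} C(|x₀| + |z₀|)` for all `t ≥ 0`. -/
theorem stmt_1
    (n m k : ℕ)
    (f : EuclideanSpace ℝ (Fin n) → EuclideanSpace ℝ (Fin m) → EuclideanSpace ℝ (Fin n))
    (hf : ContDiff ℝ (⊤ : ℕ∞) (fun p : EuclideanSpace ℝ (Fin n) × EuclideanSpace ℝ (Fin m) => f p.1 p.2))
    (hf0 : f 0 0 = 0)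
    (U : Set (EuclideanSpace ℝ (Fin m))) (hUcomp : IsCompact U) (hUne : U.Nonempty)
    (hU0 : (0 : EuclideanSpace ℝ (Fin m)) ∈ U)
    (h : EuclideanSpace ℝ (Fin n) → EuclideanSpace ℝ (Fin k)) (hh : ContDiff ℝ (⊤ : ℕ∞) h) (hh0 : h 0 = 0)
    -- (H1)
    (V : EuclideanSpace ℝ (Fin n) → ℝ) (hV : ContDiff ℝ 2 V) (hVnonneg : ∀ x, 0 ≤ V x)
    (hVradial : ∀ M : ℝ, Bornology.IsBounded {x | V x ≤ M})
    (W : EuclideanSpace ℝ (Fin n) → ℝ) (hW : ContDiff ℝ 1 W)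
    (hWpos : W 0 = 0 ∧ ∀ x ≠ 0, 0 < W x)
    (R : ℝ) (hR : 0 < R)
    (hH1 : ∀ x u, u ∈ U → R ≤ V x → ⟪gradient V x, f x u⟫ ≤ -W x)
    (hS1nhds : {x | V x ≤ R} ∈ 𝓝 (0 : EuclideanSpace ℝ (Fin n)))
    (hgradV : ∀ z, R < V z → gradient V z ≠ 0)
    -- (H2)
    (P : EuclideanSpace ℝ (Fin n) → ℝ) (hP : ContDiff ℝ 2 P)
    (hPpos : P 0 = 0 ∧ ∀ x ≠ 0, 0 < P x)
    (μ K₁ : ℝ) (hμ : 0 < μ) (hK₁ : 0 < K₁)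
    (hPlower : ∀ x, V x ≤ R → K₁ * ‖x‖ ^ 2 ≤ P x)
    (kctrl : EuclideanSpace ℝ (Fin n) → EuclideanSpace ℝ (Fin m))
    (hkU : ∀ x, kctrl x ∈ U) (hk0 : kctrl 0 = 0) (hklip : LocallyLipschitz kctrl)
    (hH2 : ∀ x, V x ≤ R → ⟪gradient P x, f x (kctrl x)⟫ ≤ -2 * μ * ‖x‖ ^ 2)
    -- (H3)
    (Q : EuclideanSpace ℝ (Fin n) →L[ℝ] EuclideanSpace ℝ (Fin n))
    (hQsym : ∀ v w : EuclideanSpace ℝ (Fin n), ⟪Q v, w⟫ = ⟪v, Q w⟫)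
    (hQpos : ∀ v : EuclideanSpace ℝ (Fin n), v ≠ 0 → 0 < ⟪v, Q v⟫)
    (ω : ℝ) (hω : 0 < ω) (b : ℝ) (hbR : R < b)
    (L : EuclideanSpace ℝ (Fin k) →L[ℝ] EuclideanSpace ℝ (Fin n))
    (hH3 : ∀ u z x, u ∈ U → V z ≤ b → V x ≤ R →
      ⟪z - x, Q (f z u + L (h z - h x) - f x u)⟫ ≤ -ω * ‖z - x‖ ^ 2)
    -- (H4)
    (c : ℝ) (hc : c ∈ Ioo (0:ℝ) 1) (a : ℝ) (haR : R ≤ a) (hab : a < b)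
    (hH4 : ∀ u z x, u ∈ U → a < V z → V z ≤ b → ⟪gradient V z, Q (z - x)⟫ < 0 → V x ≤ R →
      ⟪gradient V z, f z u + L (h z - h x)⟫ ≤ -W z +
        (1 - c) * ‖gradient V z‖ ^ 2 *
          ⟪z - x, Q (f z u + L (h z - h x) - f x u)⟫ / ⟪gradient V z, Q (z - x)⟫)
    -- the function `p`
    (p : ℝ → ℝ) (hp : LocallyLipschitz p) (hp01 : ∀ s, p s ∈ Icc (0:ℝ) 1)
    (hpb : ∀ s, b ≤ s → p s = 1) (hpa : ∀ s, s ≤ a → p s = 0)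
    -- the functions `φ` and `k̂`
    (φ : EuclideanSpace ℝ (Fin n) → EuclideanSpace ℝ (Fin k) → EuclideanSpace ℝ (Fin m) → ℝ)
    (hφ : ∀ z y u, φ z y u =
      max 0 (⟪gradient V z, f z u⟫ + W z + p (V z) * ⟪gradient V z, L (h z - y)⟫))
    (khat : EuclideanSpace ℝ (Fin n) → EuclideanSpace ℝ (Fin k) → EuclideanSpace ℝ (Fin m) →
      EuclideanSpace ℝ (Fin n))
    (hkhat1 : ∀ z y u, V z ≤ R → khat z y u = L (h z - y))
    (hkhat2 : ∀ z y u, R < V z →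
      khat z y u = L (h z - y) - (φ z y u / ‖gradient V z‖ ^ 2) • gradient V z) :
    ∃ Ts : ℝ, 0 < Ts ∧ ∃ TH : ℝ, 0 < TH ∧
      ∃ C : ℝ → ℝ, (C 0 = 0 ∧ StrictMonoOn C (Ici 0) ∧ ContinuousOn C (Ici 0) ∧
          Tendsto C atTop atTop ∧ LocallyLipschitz C) ∧
      ∃ σ : ℝ, 0 < σ ∧
      ∀ π : ℕ → ℝ, π 0 = 0 → StrictMono π → Tendsto π atTop atTop →
        (∀ i, π (i + 1) - π i ≤ Ts) →
      ∀ z₀ x₀ : EuclideanSpace ℝ (Fin n),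
      ∃ (x z : ℝ → EuclideanSpace ℝ (Fin n)) (w : ℝ → EuclideanSpace ℝ (Fin k))
        (u : ℝ → EuclideanSpace ℝ (Fin m)),
        IsClosedLoopSolDF f h khat kctrl TH π z₀ x₀ x z w u ∧
        (∀ (x' z' : ℝ → EuclideanSpace ℝ (Fin n)) (w' : ℝ → EuclideanSpace ℝ (Fin k))
            (u' : ℝ → EuclideanSpace ℝ (Fin m)),
          IsClosedLoopSolDF f h khat kctrl TH π z₀ x₀ x' z' w' u' →
            ∀ t, 0 ≤ t → x' t = x t ∧ z' t = z t ∧ w' t = w t ∧ u' t = u t) ∧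
        ∀ t, 0 ≤ t →
          ‖x t‖ + ‖z t‖ ≤ Real.exp (-σ * t) * C (‖x₀‖ + ‖z₀‖) := by
  have D : ObserverDesign f U h V W R P μ K₁ kctrl Q ω b L c a p φ khat :=
    { f_contDiff := by exact_mod_cast contDiff_infty.1 hf 2
      f_zero := hf0
      isCompact := hUcomp
      h_contDiff := by exact_mod_cast contDiff_infty.1 hh 2
      h_zero := hh0
      V_contDiff := hV
      V_radial := hVradial
      W_contDiff := hW
      W_pos := hWpos.2
      R_pos := hR
      V_decay := hH1
      V_nhds := hS1nhds
      gradient_ne_zero := hgradV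
      P_contDiff := hP
      P_zero := hPpos.1
      P_pos := hPpos.2
      μ_pos := hμ
      K₁_pos := hK₁
      P_lower := hPlower
      kc_mem := hkU
      kc_zero := hk0
      kc_lip := hklip
      P_decay := hH2
      Q_symm := hQsym
      Q_pos := hQpos
      ω_pos := hω
      R_lt_b := hbR
      error_decay := hH3
      c_mem := hc
      R_le_a := haR
      V_observer_decay := hH4
      p_lip := hp
      p_mem := hp01
      p_one := hpb
      p_zero := hpa
      φ_eq := hφ
      khat_inner := hkhat1
      khat_outer := hkhat2 }
  have H := D.loopRegular
  obtain ⟨Δ, σ, Γ, hΔ, hΔ1, hσ, hdecay⟩ := D.exists_uniform_decay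
  obtain ⟨C, hC, hΓC⟩ := exists_kInfinity_majorant fun N => 2 * |Γ N|
  refine ⟨Δ, hΔ, Δ, hΔ, C, hC, σ, hσ, fun π hπ0 hπmono hπtop hπΔ z₀ x₀ => ?_⟩
  have hπ : IsPartition π := ⟨hπ0, hπmono, hπtop⟩
  have hπ1 : ∀ i, π (i + 1) - π i ≤ 1 := fun i => (hπΔ i).trans hΔ1
  have hθ := isPartition_natCast_mul hΔ
  have hθΔ : ∀ i : ℕ, ((i + 1 : ℕ) : ℝ) * Δ - (i : ℝ) * Δ ≤ Δ := fun i => by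
    push_cast
    linarith
  obtain ⟨ξ, hξ, hsol⟩ := D.exists_eq_integral_loopField hθ hπ hπ1 (x₀, z₀)
  have hξsol := H.isClosedLoopSolDF hΔ hπ hπ1 hξ hsol
  refine ⟨_, _, _, _, hξsol, fun x' z' w' u' hs' t ht =>
    H.closedLoopSol_unique hΔ hπ hπ1 hξsol hs' ht, fun t ht => ?_⟩
  have hξ₀ : ‖(x₀, z₀)‖ ≤ ‖x₀‖ + ‖z₀‖ := LoopRegular.norm_prodMk_le_add _ _
  have h1 := hdecay _ π hθ hπ hθΔ hπΔ ξ (x₀, z₀) hξ hsol _ (hξ₀.trans (Nat.le_ceil _)) t ht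
  have h2 : Γ ⌈‖x₀‖ + ‖z₀‖⌉₊ * ‖(x₀, z₀)‖ ≤ |Γ ⌈‖x₀‖ + ‖z₀‖⌉₊| * (‖x₀‖ + ‖z₀‖) :=
    mul_le_mul (le_abs_self _) hξ₀ (norm_nonneg _) (abs_nonneg _)
  calc ‖(ξ t).1‖ + ‖(ξ t).2‖ ≤ 2 * ‖ξ t‖ := by linarith [norm_fst_le (ξ t), norm_snd_le (ξ t)]
    _ ≤ Real.exp (-σ * t) * (2 * |Γ ⌈‖x₀‖ + ‖z₀‖⌉₊| * (‖x₀‖ + ‖z₀‖)) := by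
      have h3 := mul_le_mul_of_nonneg_left h2 (Real.exp_pos (-σ * t)).le
      linarith
    _ ≤ _ := mul_le_mul_of_nonneg_left (hΓC _ (by positivity)) (Real.exp_pos _).le
end

section
/- There exists a continuous function T : ℝ^n → [0,∞) such that for every x_0 ∈ ℝ^n, every measurable essentially bounded input u : [−τ, ∞) → U and every absolutely continuous function x : [0,∞) → ℝ^n satisfying ẋ(t) = f(x(t), u(t−τ)) for almost every t ≥ 0 and x(0) = x_0, one has V(x(t)) ≤ R for all t ≥ T(x_0). -/
open MeasureTheory Set Filter
open scoped RealInnerProductSpace Topology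

/-- A `C¹` function `V` decreases at rate at least `δ` along a primitive `x` of a bounded
integrable function `g`, as soon as its formal derivative along `x` is at most `-δ`. -/
lemma ContDiff.sub_le_of_fderiv_le_along_primitive
    {E : Type*} [NormedAddCommGroup E] [NormedSpace ℝ E] [FiniteDimensional ℝ E]
    {V : E → ℝ} (hV : ContDiff ℝ 1 V) {g x : ℝ → E} {x₀ : E} {a b C δ : ℝ}
    (ha : 0 ≤ a) (hab : a ≤ b) (hg : IntervalIntegrable g volume 0 b)
    (hC : ∀ t ∈ Icc 0 b, ‖g t‖ ≤ C)
    (hx : ∀ t, 0 ≤ t → x t = x₀ + ∫ s in (0 : ℝ)..t, g s)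
    (hδ : ∀ t ∈ Icc a b, fderiv ℝ V (x t) (g t) ≤ -δ) :
    V (x b) - V (x a) ≤ -δ * (b - a) := by
  have : CompleteSpace E := FiniteDimensional.complete ℝ E
  have hb : 0 ≤ b := ha.trans hab
  have hgi : ∀ s ∈ Icc 0 b, IntervalIntegrable g volume 0 s := fun s hs =>
    hg.mono_set (by rw [uIcc_of_le hs.1, uIcc_of_le hb]; exact Icc_subset_Icc le_rfl hs.2)
  have hC0 : 0 ≤ C := (norm_nonneg _).trans (hC 0 ⟨le_rfl, hb⟩)
  have hLip : LipschitzOnWith C.toNNReal x (Icc 0 b) := by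
    refine LipschitzOnWith.of_dist_le_mul fun s hs t ht => ?_
    rw [Real.coe_toNNReal C hC0, dist_eq_norm, hx s hs.1, hx t ht.1, add_sub_add_left_eq_sub,
      intervalIntegral.integral_interval_sub_left (hgi s hs) (hgi t ht), Real.dist_eq]
    refine intervalIntegral.norm_integral_le_of_norm_le_const fun r hr => hC r ?_
    exact (ordConnected_Icc.uIcc_subset ht hs) (uIoc_subset_uIcc hr)
  obtain ⟨r, hr⟩ := (isCompact_Icc.image_of_continuousOn hLip.continuousOn).isBounded.subset_closedBall
    (0 : E)
  obtain ⟨K, hK⟩ := hV.contDiffOn.exists_lipschitzOnWith one_ne_zero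
    (convex_closedBall (0 : E) r) (isCompact_closedBall (0 : E) r)
  have hsub : uIcc a b ⊆ Icc 0 b := by
    rw [uIcc_of_le hab]; exact Icc_subset_Icc ha le_rfl
  have hφ : AbsolutelyContinuousOnInterval (V ∘ x) a b :=
    ((hK.comp hLip fun t ht => hr (mem_image_of_mem x ht)).mono hsub).absolutelyContinuousOnInterval
  have hderiv : ∀ᵐ t, t ∈ Icc a b → deriv (V ∘ x) t ≤ -δ := by
    have h0 : ∀ᵐ t : ℝ, t ≠ 0 := by simp [ae_iff, measure_singleton]
    filter_upwards [hg.ae_hasDerivAt_integral, h0] with t ht ht0 hta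
    have htb : t ∈ uIcc 0 b := by
      rw [uIcc_of_le hb]; exact ⟨ha.trans hta.1, hta.2⟩
    have hxd : HasDerivAt x (g t) t := by
      refine ((ht htb 0 left_mem_uIcc).const_add x₀).congr_of_eventuallyEq ?_
      filter_upwards [Ioi_mem_nhds (lt_of_le_of_ne (ha.trans hta.1) ht0.symm)] with s hs
      exact hx s (le_of_lt hs)
    rw [((hV.differentiable one_ne_zero (x t)).hasFDerivAt.comp_hasDerivAt t hxd).deriv]
    exact hδ t hta
  calc V (x b) - V (x a) = ∫ t in a..b, deriv (V ∘ x) t := hφ.integral_deriv_eq_sub.symm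
    _ ≤ ∫ _ in a..b, -δ := by
        refine intervalIntegral.integral_mono_ae_restrict hab hφ.intervalIntegrable_deriv
          intervalIntegrable_const ?_
        exact (ae_restrict_iff' measurableSet_Icc).2 hderiv
    _ = -δ * (b - a) := by simp [mul_comm]

/-- A continuous function on `[0, b]` which is nonincreasing over any subinterval ending at `b` on
which it stays above the level `R`, and which exceeds `R` at `b`, exceeds `R` on `[0, b]`. -/
lemma lt_on_Icc_of_lt_right {φ : ℝ → ℝ} {b R : ℝ} (hφ : ContinuousOn φ (Icc 0 b))
    (hmono : ∀ a ∈ Icc 0 b, (∀ t ∈ Icc a b, R ≤ φ t) → φ b ≤ φ a) (hb : R < φ b) :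
    ∀ t ∈ Icc 0 b, R < φ t := by
  by_contra! h
  obtain ⟨t, ht, htR⟩ := h
  have hclosed : IsClosed (Icc 0 b ∩ φ ⁻¹' Iic R) :=
    hφ.preimage_isClosed_of_isClosed isClosed_Icc isClosed_Iic
  have hcomp : IsCompact (Icc 0 b ∩ φ ⁻¹' Iic R) :=
    isCompact_Icc.of_isClosed_subset hclosed inter_subset_left
  obtain ⟨s, ⟨hs, hsR⟩, hmax⟩ := hcomp.exists_isGreatest ⟨t, ht, htR⟩
  have hsR : φ s ≤ R := hsR
  have hgt : ∀ r ∈ Icc 0 b, s < r → R < φ r := fun r hr hsr => by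
    by_contra! hle
    exact (hmax ⟨hr, hle⟩).not_gt hsr
  have hsb : s < b := lt_of_le_of_ne hs.2 (by rintro rfl; linarith)
  have hRs : R ≤ φ s := by
    have hlim : Tendsto φ (𝓝[Ioo s b] s) (𝓝 (φ s)) :=
      (hφ s hs).mono (Ioo_subset_Icc_self.trans (Icc_subset_Icc hs.1 le_rfl))
    have : (𝓝[Ioo s b] s).NeBot := by
      rw [nhdsWithin_Ioo_eq_nhdsGT hsb]; infer_instance
    refine ge_of_tendsto hlim ?_
    filter_upwards [self_mem_nhdsWithin] with r hr
    exact (hgt r ⟨hs.1.trans hr.1.le, hr.2.le⟩ hr.1).le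
  refine absurd (hmono s hs fun r hr => ?_) (by linarith)
  rcases hr.1.eq_or_lt with rfl | hsr
  · exact hRs
  · exact (hgt r ⟨hs.1.trans hr.1, hr.2⟩ hsr).le

/-- A continuous function which is positive away from `0` has a positive lower bound on the part of
a bounded sublevel set of `V` lying outside a neighbourhood of `0`. -/
lemma exists_pos_le_of_lt_of_le {E : Type*} [NormedAddCommGroup E] [NormedSpace ℝ E]
    [FiniteDimensional ℝ E] {V W : E → ℝ} {R M : ℝ} (hV : Continuous V) (hW : Continuous W)
    (hWpos : ∀ x ≠ 0, 0 < W x) (hVM : Bornology.IsBounded {x | V x ≤ M})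
    (hR : {x | V x ≤ R} ∈ 𝓝 (0 : E)) :
    ∃ δ > 0, ∀ x, R < V x → V x ≤ M → δ ≤ W x := by
  have : ProperSpace E := FiniteDimensional.proper ℝ E
  have hK : IsCompact ({x | V x ≤ M} ∩ (interior {x | V x ≤ R})ᶜ) :=
    Metric.isCompact_of_isClosed_isBounded
      ((isClosed_le hV continuous_const).inter isOpen_interior.isClosed_compl)
      (hVM.subset inter_subset_left)
  obtain ⟨δ, hδ, hle⟩ := hK.exists_forall_le' (f := W) (a := 0) hW.continuousOn fun x hx =>
    hWpos x (by rintro rfl; exact hx.2 (mem_interior_iff_mem_nhds.2 hR))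
  exact ⟨δ, hδ, fun x hxR hxM => hle x ⟨hxM, fun h => (interior_subset h).not_gt hxR⟩⟩

/-- Under assumption (H1), there exists a continuous function
`T : ℝⁿ → [0,∞)` such that for every initial state `x₀`, every measurable essentially
bounded input `u : [−τ,∞) → U` and every absolutely continuous (Carathéodory) solution
`x` of `ẋ(t) = f(x(t), u(t−τ))` on `[0,∞)` with `x(0) = x₀`, one has `V(x(t)) ≤ R` for
all `t ≥ T(x₀)`. -/
theorem stmt_3
    (n m : ℕ)
    (f : EuclideanSpace ℝ (Fin n) → EuclideanSpace ℝ (Fin m) → EuclideanSpace ℝ (Fin n))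
    (hf : ContDiff ℝ (⊤ : ℕ∞) (fun p : EuclideanSpace ℝ (Fin n) × EuclideanSpace ℝ (Fin m) => f p.1 p.2))
    (hf0 : f 0 0 = 0)
    (U : Set (EuclideanSpace ℝ (Fin m))) (hUcomp : IsCompact U) (hUne : U.Nonempty)
    (hU0 : (0 : EuclideanSpace ℝ (Fin m)) ∈ U)
    (τ : ℝ) (hτ : 0 ≤ τ)
    -- (H1)
    (V : EuclideanSpace ℝ (Fin n) → ℝ) (hV : ContDiff ℝ 2 V) (hVnonneg : ∀ x, 0 ≤ V x)
    (hVradial : ∀ M : ℝ, Bornology.IsBounded {x | V x ≤ M})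
    (W : EuclideanSpace ℝ (Fin n) → ℝ) (hW : ContDiff ℝ 1 W)
    (hWpos : W 0 = 0 ∧ ∀ x ≠ 0, 0 < W x)
    (R : ℝ) (hR : 0 < R)
    (hH1 : ∀ x u, u ∈ U → R ≤ V x → ⟪gradient V x, f x u⟫ ≤ -W x)
    (hS1nhds : {x | V x ≤ R} ∈ 𝓝 (0 : EuclideanSpace ℝ (Fin n))) :
    ∃ T : EuclideanSpace ℝ (Fin n) → ℝ, Continuous T ∧ (∀ x, 0 ≤ T x) ∧
      ∀ (x₀ : EuclideanSpace ℝ (Fin n)) (u : ℝ → EuclideanSpace ℝ (Fin m)),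
        Measurable u → (∀ t, -τ ≤ t → u t ∈ U) →
        ∀ x : ℝ → EuclideanSpace ℝ (Fin n), ContinuousOn x (Ici 0) → x 0 = x₀ →
          (∀ t, 0 ≤ t → x t = x₀ + ∫ s in (0:ℝ)..t, f (x s) (u (s - τ))) →
          ∀ t, T x₀ ≤ t → V (x t) ≤ R := by
  let S : EuclideanSpace ℝ (Fin n) → Set ℝ := fun x₀ => {c | 0 ≤ c ∧
    ∀ u : ℝ → EuclideanSpace ℝ (Fin m), Measurable u → (∀ t, -τ ≤ t → u t ∈ U) →
      ∀ x : ℝ → EuclideanSpace ℝ (Fin n), ContinuousOn x (Ici 0) → x 0 = x₀ →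
        (∀ t, 0 ≤ t → x t = x₀ + ∫ s in (0:ℝ)..t, f (x s) (u (s - τ))) →
        ∀ t, c ≤ t → V (x t) ≤ R}
  have hSconv : ∀ x₀, Convex ℝ (S x₀) := fun x₀ => by
    refine OrdConnected.convex (IsUpperSet.ordConnected ?_)
    exact fun c d hcd hc => ⟨hc.1.trans hcd, fun u hu huU x hxc hx0 hx t ht =>
      hc.2 u hu huU x hxc hx0 hx t (hcd.trans ht)⟩
  suffices h : ∀ x₀, ∃ c, ∀ᶠ y in 𝓝 x₀, c ∈ S y by
    obtain ⟨T, hT⟩ := exists_continuous_forall_mem_convex_of_local_const hSconv h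
    exact ⟨T, T.continuous, fun x => (hT x).1, fun x₀ => (hT x₀).2⟩
  intro z
  set M := max (V z + 1) R
  have hRM : R ≤ M := le_max_right _ _
  have hM : 0 < M := hR.trans_le hRM
  obtain ⟨δ, hδ, hWδ⟩ := exists_pos_le_of_lt_of_le hV.continuous hW.continuous hWpos.2
    (hVradial M) hS1nhds
  refine ⟨M / δ, ?_⟩
  filter_upwards [hV.continuous.continuousAt.eventually_lt continuousAt_const
    (lt_of_lt_of_le (lt_add_one (V z)) (le_max_left _ R))] with y hy
  refine ⟨by positivity, fun u hu huU x hxc hx0 hx b hb => ?_⟩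
  have hb0 : 0 ≤ b := le_trans (by positivity) hb
  by_contra! hbR
  have hxcb : ContinuousOn x (Icc 0 b) := hxc.mono Icc_subset_Ici_self
  have huU' : ∀ t ∈ Icc 0 b, u (t - τ) ∈ U := fun t ht => huU _ (by linarith [ht.1])
  obtain ⟨C, hC⟩ := ((isCompact_Icc.image_of_continuousOn hxcb).prod
    hUcomp).exists_bound_of_continuousOn hf.continuous.continuousOn
  have hgC : ∀ t ∈ Icc 0 b, ‖f (x t) (u (t - τ))‖ ≤ C := fun t ht =>
    hC (x t, u (t - τ)) ⟨mem_image_of_mem x ht, huU' t ht⟩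
  have hgi : IntervalIntegrable (fun t => f (x t) (u (t - τ))) volume 0 b := by
    rw [intervalIntegrable_iff_integrableOn_Icc_of_le hb0]
    refine Integrable.of_bound ?_ C
      ((ae_restrict_iff' measurableSet_Icc).2 (Eventually.of_forall hgC))
    exact hf.continuous.comp_aestronglyMeasurable
      ((hxcb.aestronglyMeasurable measurableSet_Icc).prodMk
        (hu.comp (measurable_id.sub_const τ)).aestronglyMeasurable)
  have hVdec : ∀ a ∈ Icc 0 b, ∀ c ∈ Icc a b, ∀ ε, (∀ t ∈ Icc a c, R ≤ V (x t)) →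
      (∀ t ∈ Icc a c, ε ≤ W (x t)) → V (x c) - V (x a) ≤ -ε * (c - a) := by
    intro a ha c hc ε hRa hε
    have hc0 : c ∈ Icc 0 b := ⟨ha.1.trans hc.1, hc.2⟩
    refine (hV.of_le one_le_two).sub_le_of_fderiv_le_along_primitive ha.1 hc.1
      (hgi.mono_set (by
        rw [uIcc_of_le hc0.1, uIcc_of_le hb0]; exact Icc_subset_Icc le_rfl hc.2))
      (fun t ht => hgC t ⟨ht.1, ht.2.trans hc.2⟩) hx fun t ht => ?_
    have h := hH1 (x t) _ (huU' t ⟨ha.1.trans ht.1, ht.2.trans hc.2⟩) (hRa t ht)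
    rw [inner_gradient_left] at h
    linarith [hε t ht]
  have hW0 : ∀ z, 0 ≤ W z := fun z => by
    by_cases hz : z = 0
    · rw [hz, hWpos.1]
    · exact (hWpos.2 z hz).le
  have hgt : ∀ t ∈ Icc 0 b, R < V (x t) :=
    lt_on_Icc_of_lt_right (φ := V ∘ x) (hV.continuous.comp_continuousOn hxcb)
      (fun a ha hRa => by
        have := hVdec a ha b ⟨ha.2, le_rfl⟩ 0 hRa fun t _ => hW0 _
        simp only [Function.comp_apply]
        linarith) hbR
  have h0 : (0 : ℝ) ∈ Icc 0 b := ⟨le_rfl, hb0⟩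
  have hle : ∀ t ∈ Icc 0 b, V (x t) ≤ M := fun t ht => by
    have := hVdec 0 h0 t ht 0 (fun s hs => (hgt s ⟨hs.1, hs.2.trans ht.2⟩).le) fun s _ => hW0 _
    rw [hx0] at this
    linarith
  have hfinal := hVdec 0 h0 b ⟨hb0, le_rfl⟩ δ (fun t ht => (hgt t ht).le)
    fun t ht => hWδ _ (hgt t ht) (hle t ht)
  rw [hx0] at hfinal
  have hMb : M ≤ b * δ := (div_le_iff₀ hδ).1 hb
  linarith
end
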